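/- For every integer n ≥ 14: every 𝒫₄-free 3-graph H on n vertices that is isomorphic to a sub-3-graph of neither the starplus Sₙ^{+1} nor the compact balloon CBₙ satisfies |H| ≤ C(n−4,2) + 11, and equality holds if and only if H is isomorphic to the balloon Bₙ. -/

import Mathlib

open Finset

/-- `H` is a 3-graph on the vertex set `V`: every edge is a 3-element subset of `V`. -/
def ThreeGraphOn (V : Finset ℕ) (H : Finset (Finset ℕ)) : Prop :=
  ∀ e ∈ H, e ⊆ V ∧ e.card = 3

/-- Four edges form a 3-uniform minimal 4-path: `aᵢ ∩ aⱼ ≠ ∅ ↔ |i - j| ≤ 1`. -/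
def IsMinPath4 (a₀ a₁ a₂ a₃ : Finset ℕ) : Prop :=
  (a₀ ∩ a₁).Nonempty ∧ (a₁ ∩ a₂).Nonempty ∧ (a₂ ∩ a₃).Nonempty ∧
    a₀ ∩ a₂ = ∅ ∧ a₀ ∩ a₃ = ∅ ∧ a₁ ∩ a₃ = ∅

/-- `H` contains no minimal 4-path. -/
def P4Free (H : Finset (Finset ℕ)) : Prop :=
  ¬∃ a₀ ∈ H, ∃ a₁ ∈ H, ∃ a₂ ∈ H, ∃ a₃ ∈ H, IsMinPath4 a₀ a₁ a₂ a₃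

/-- `H` is a starplus on `V`: a full star with center `v` together with one
extra 3-edge not containing `v`. -/
def IsStarPlusOn (V : Finset ℕ) (H : Finset (Finset ℕ)) : Prop :=
  ∃ v ∈ V, ∃ e : Finset ℕ, e ⊆ V ∧ e.card = 3 ∧ v ∉ e ∧
    H = (V.powersetCard 3).filter (fun t => v ∈ t) ∪ {e}

/-- `H` is (isomorphic to) a sub-3-graph of the starplus on `V`. -/
def SubStarPlus (V : Finset ℕ) (H : Finset (Finset ℕ)) : Prop :=
  ∃ H' : Finset (Finset ℕ), IsStarPlusOn V H' ∧ H ⊆ H'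

/-- `H` is the compact balloon `CBₙ` on `V`: a full star on `V \ {z₁, z₂}`
with center `x`, together with the seven extra edges `{y₁,y₂,z₁}`,
`{y₁,y₂,z₂}`, `{x,yᵢ,zⱼ}` for `i,j ∈ {1,2}`, and `{x,z₁,z₂}`. -/
def IsCBOn (V : Finset ℕ) (H : Finset (Finset ℕ)) : Prop :=
  ∃ x y₁ y₂ z₁ z₂ : ℕ, ({x, y₁, y₂, z₁, z₂} : Finset ℕ) ⊆ V ∧
    ({x, y₁, y₂, z₁, z₂} : Finset ℕ).card = 5 ∧
    H = ((V \ {z₁, z₂}).powersetCard 3).filter (fun t => x ∈ t) ∪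
      ({{y₁, y₂, z₁}, {y₁, y₂, z₂}, {x, y₁, z₁}, {x, y₁, z₂},
        {x, y₂, z₁}, {x, y₂, z₂}, {x, z₁, z₂}} : Finset (Finset ℕ))

/-- `H` is (isomorphic to) a sub-3-graph of `CBₙ` on `V`. -/
def SubCB (V : Finset ℕ) (H : Finset (Finset ℕ)) : Prop :=
  ∃ H' : Finset (Finset ℕ), IsCBOn V H' ∧ H ⊆ H'

/-- `H` is the balloon `Bₙ` on `V`: a full star on `V \ {z₁, z₂, z₃}` with
center `x`, together with the eleven extra edges `{y₁,y₂,y₃}`, `{z₁,z₂,z₃}`,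
and `{x,yᵢ,zⱼ}` for `i,j ∈ {1,2,3}`. -/
def IsBOn (V : Finset ℕ) (H : Finset (Finset ℕ)) : Prop :=
  ∃ x y₁ y₂ y₃ z₁ z₂ z₃ : ℕ, ({x, y₁, y₂, y₃, z₁, z₂, z₃} : Finset ℕ) ⊆ V ∧
    ({x, y₁, y₂, y₃, z₁, z₂, z₃} : Finset ℕ).card = 7 ∧
    H = ((V \ {z₁, z₂, z₃}).powersetCard 3).filter (fun t => x ∈ t) ∪
      ({{y₁, y₂, y₃}, {z₁, z₂, z₃},
        {x, y₁, z₁}, {x, y₁, z₂}, {x, y₁, z₃},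
        {x, y₂, z₁}, {x, y₂, z₂}, {x, y₂, z₃},
        {x, y₃, z₁}, {x, y₃, z₂}, {x, y₃, z₃}} : Finset (Finset ℕ))

lemma p4 {H : Finset (Finset ℕ)} (hf : P4Free H) {a b c d : Finset ℕ} (ha : a ∈ H) (hb : b ∈ H)
    (hc : c ∈ H) (hd : d ∈ H) (h1 : ¬Disjoint a b) (h2 : ¬Disjoint b c) (h3 : ¬Disjoint c d)
    (h4 : Disjoint a c) (h5 : Disjoint a d) (h6 : Disjoint b d) : False := by
  apply hf
  refine ⟨a, ha, b, hb, c, hc, d, hd, ?_, ?_, ?_, ?_, ?_, ?_⟩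
  · rwa [← Finset.not_disjoint_iff_nonempty_inter]
  · rwa [← Finset.not_disjoint_iff_nonempty_inter]
  · rwa [← Finset.not_disjoint_iff_nonempty_inter]
  · rwa [← Finset.disjoint_iff_inter_eq_empty]
  · rwa [← Finset.disjoint_iff_inter_eq_empty]
  · rwa [← Finset.disjoint_iff_inter_eq_empty]

lemma P4Free.mono {H K : Finset (Finset ℕ)} (hf : P4Free H) (h : K ⊆ H) : P4Free K := by
  rintro ⟨a, ha, b, hb, c, hc, d, hd, hp⟩
  exact hf ⟨a, h ha, b, h hb, c, h hc, d, h hd, hp⟩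

lemma ThreeGraphOn.mono {V : Finset ℕ} {H K : Finset (Finset ℕ)} (hf : ThreeGraphOn V H)
    (h : K ⊆ H) : ThreeGraphOn V K := fun e he => hf e (h he)

lemma ThreeGraphOn.filt {V : Finset ℕ} {H : Finset (Finset ℕ)} (hf : ThreeGraphOn V H)
    (p : Finset ℕ → Prop) [DecidablePred p] : ThreeGraphOn V (H.filter p) :=
  hf.mono (filter_subset _ _)

lemma card_sup {V S : Finset ℕ} {F : Finset (Finset ℕ)} (hF : ThreeGraphOn V F)
    (hS : ∀ f ∈ F, S ⊆ f) : F.card ≤ (V.card - S.card).choose (3 - S.card) := by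
  rcases F.eq_empty_or_nonempty with rfl | ⟨f0, hf0⟩
  · simp
  have hSV : S ⊆ V := (hS f0 hf0).trans (hF f0 hf0).1
  rw [← card_sdiff_of_subset hSV, ← card_powersetCard]
  apply Finset.card_le_card_of_injOn (fun f => f \ S)
  · intro f hf
    simp only [mem_coe, mem_powersetCard]
    refine ⟨sdiff_subset_sdiff (hF f hf).1 le_rfl, ?_⟩
    rw [card_sdiff_of_subset (hS f hf), (hF f hf).2]
  · intro f hf g hg hfg
    simp only at hfg
    rw [← sdiff_union_of_subset (hS f hf), hfg, sdiff_union_of_subset (hS g hg)]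

lemma card_all {V : Finset ℕ} {F : Finset (Finset ℕ)} (hF : ThreeGraphOn V F) :
    F.card ≤ V.card.choose 3 := by
  simpa using card_sup (S := ∅) hF (by simp)

lemma card_star {V : Finset ℕ} {F : Finset (Finset ℕ)} (hF : ThreeGraphOn V F) {p : ℕ}
    (hp : ∀ f ∈ F, p ∈ f) : F.card ≤ (V.card - 1).choose 2 := by
  simpa using card_sup (S := {p}) hF (by simpa using hp)

lemma card_pr {V : Finset ℕ} {F : Finset (Finset ℕ)} (hF : ThreeGraphOn V F) {p q : ℕ}
    (hpq : p ≠ q) (hp : ∀ f ∈ F, p ∈ f ∧ q ∈ f) : F.card ≤ V.card - 2 := by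
  have := card_sup (S := {p, q}) hF (by
    intro f hf; rw [insert_subset_iff, singleton_subset_iff]; exact hp f hf)
  rw [card_pair hpq] at this
  simpa using this

lemma card_trip {V : Finset ℕ} {F : Finset (Finset ℕ)} (hF : ThreeGraphOn V F) {p q r : ℕ}
    (hpq : p ≠ q) (hpr : p ≠ r) (hqr : q ≠ r) (hp : ∀ f ∈ F, p ∈ f ∧ q ∈ f ∧ r ∈ f) :
    F.card ≤ 1 := by
  have := card_sup (S := {p, q, r}) hF (by
    intro f hf; rw [insert_subset_iff, insert_subset_iff, singleton_subset_iff]; exact hp f hf)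
  rw [card_eq_three.2 ⟨p, q, r, hpq, hpr, hqr, rfl⟩] at this
  simpa using this

lemma card_star_hit {V S : Finset ℕ} {F : Finset (Finset ℕ)} (hF : ThreeGraphOn V F) {p : ℕ}
    (hpV : p ∈ V) (hSV : S ⊆ V) (hpS : p ∉ S)
    (hp : ∀ f ∈ F, p ∈ f) (hS : ∀ f ∈ F, ¬Disjoint f S) :
    F.card + (V.card - 1 - S.card).choose 2 ≤ (V.card - 1).choose 2 := by
  have h1 : F.card + (((V.erase p) \ S).powersetCard 2).card ≤ ((V.erase p).powersetCard 2).card := by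
    have : F.card = (F.image (fun f => f.erase p)).card := by
      rw [card_image_of_injOn]
      intro f hf g hg hfg
      simp only at hfg
      rw [← insert_erase (hp f hf), hfg, insert_erase (hp g hg)]
    rw [this, ← card_union_of_disjoint]
    · apply card_le_card
      apply union_subset
      · intro g hg
        obtain ⟨f, hf, rfl⟩ := mem_image.1 hg
        rw [mem_powersetCard]
        refine ⟨erase_subset_erase _ (hF f hf).1, ?_⟩
        rw [card_erase_of_mem (hp f hf), (hF f hf).2]
      · exact powersetCard_mono sdiff_subset
    · rw [disjoint_left]
      intro g hg hg2
      obtain ⟨f, hf, rfl⟩ := mem_image.1 hg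
      rw [mem_powersetCard] at hg2
      apply hS f hf
      rw [disjoint_left]
      intro v hv hvS
      have : v ∈ f.erase p := mem_erase.2 ⟨fun h => hpS (h ▸ hvS), hv⟩
      exact (mem_sdiff.1 (hg2.1 this)).2 hvS
  rw [card_powersetCard, card_powersetCard, card_sdiff_of_subset (subset_erase.2 ⟨hSV, hpS⟩),
    card_erase_of_mem hpV] at h1
  exact h1

lemma c2 (n : ℕ) : (n + 1).choose 2 = n.choose 2 + n := by
  rw [Nat.choose_succ_succ' n 1]; simp; omega

lemma card_star_hit2 {V S : Finset ℕ} {F : Finset (Finset ℕ)} (hF : ThreeGraphOn V F) {p : ℕ}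
    (hpV : p ∈ V) (hSV : S ⊆ V) (hpS : p ∉ S) (hS2 : S.card = 2)
    (hp : ∀ f ∈ F, p ∈ f) (hS : ∀ f ∈ F, ¬Disjoint f S) : F.card + 5 ≤ 2 * V.card := by
  have h := card_star_hit hF hpV hSV hpS hp hS
  have h3 : (insert p S).card ≤ V.card := card_le_card (insert_subset hpV hSV)
  rw [card_insert_of_notMem hpS, hS2] at h3
  obtain ⟨k, hk⟩ := Nat.exists_eq_add_of_le h3
  rw [hk, hS2] at h
  rw [show 2 + 1 + k - 1 - 2 = k by omega, show 2 + 1 + k - 1 = k + 1 + 1 by omega, c2, c2] at h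
  omega

lemma card_star_hit3 {V S : Finset ℕ} {F : Finset (Finset ℕ)} (hF : ThreeGraphOn V F) {p : ℕ}
    (hpV : p ∈ V) (hSV : S ⊆ V) (hpS : p ∉ S) (hS2 : S.card = 3)
    (hp : ∀ f ∈ F, p ∈ f) (hS : ∀ f ∈ F, ¬Disjoint f S) : F.card + 9 ≤ 3 * V.card := by
  have h := card_star_hit hF hpV hSV hpS hp hS
  have h3 : (insert p S).card ≤ V.card := card_le_card (insert_subset hpV hSV)
  rw [card_insert_of_notMem hpS, hS2] at h3
  obtain ⟨k, hk⟩ := Nat.exists_eq_add_of_le h3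
  rw [hk, hS2] at h
  rw [show 3 + 1 + k - 1 - 3 = k by omega, show 3 + 1 + k - 1 = k + 1 + 1 + 1 by omega, c2, c2, c2] at h
  omega

lemma branch {S : Finset ℕ} {F : Finset (Finset ℕ)} {k : ℕ} (hS : ∀ f ∈ F, ¬Disjoint f S)
    (h : ∀ v ∈ S, (F.filter (v ∈ ·)).card ≤ k) : F.card ≤ S.card * k := by
  have : F ⊆ S.biUnion (fun v => F.filter (v ∈ ·)) := by
    intro f hf
    obtain ⟨v, hv, hvS⟩ := not_disjoint_iff.1 (hS f hf)
    exact mem_biUnion.2 ⟨v, hvS, mem_filter.2 ⟨hf, hv⟩⟩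
  exact (card_le_card this).trans (card_biUnion_le_card_mul _ _ _ h)

lemma splitp {F : Finset (Finset ℕ)} (p : Finset ℕ → Prop) [DecidablePred p] :
    F.card = (F.filter p).card + (F.filter (fun f => ¬ p f)).card :=
  (card_filter_add_card_filter_not p).symm

/-- `F ⊆ V.erase q`-graph -/
lemma ThreeGraphOn.erase {V : Finset ℕ} {F : Finset (Finset ℕ)} (hF : ThreeGraphOn V F) {q : ℕ}
    (h : ∀ f ∈ F, q ∉ f) : ThreeGraphOn (V.erase q) F :=
  fun f hf => ⟨subset_erase.2 ⟨(hF f hf).1, h f hf⟩, (hF f hf).2⟩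

/-- all members hit two disjoint pairs -/
lemma card_hit22 {V : Finset ℕ} {F : Finset (Finset ℕ)} (hF : ThreeGraphOn V F) {P Q : Finset ℕ}
    (hP : P ⊆ V) (hQ : Q ⊆ V) (hP2 : P.card = 2) (hQ2 : Q.card = 2) (hPQ : Disjoint P Q)
    (h1 : ∀ f ∈ F, ¬Disjoint f P) (h2 : ∀ f ∈ F, ¬Disjoint f Q) : F.card + 12 ≤ 4 * V.card := by
  obtain ⟨a, b, hab, rfl⟩ := card_eq_two.1 hP2
  have haV : a ∈ V := hP (by simp)
  have hbV : b ∈ V := hP (by simp)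
  have haQ : a ∉ Q := disjoint_left.1 hPQ (by simp)
  have hbQ : b ∉ Q := disjoint_left.1 hPQ (by simp)
  have e1 := splitp (F := F) (a ∈ ·)
  have e2 := card_star_hit2 (hF.filt (a ∈ ·)) haV hQ haQ hQ2 (fun f hf => (mem_filter.1 hf).2)
    (fun f hf => h2 f (mem_filter.1 hf).1)
  have e3 := card_star_hit2 (V := V.erase a) (p := b) ((hF.filt (fun f => ¬ a ∈ f)).erase (q := a) (fun f hf => (mem_filter.1 hf).2))
    (mem_erase.2 ⟨hab.symm, hbV⟩) (subset_erase.2 ⟨hQ, haQ⟩) hbQ hQ2 (by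
      intro f hf
      obtain ⟨hf, ha⟩ := mem_filter.1 hf
      obtain ⟨v, hv, hvS⟩ := not_disjoint_iff.1 (h1 f hf)
      simp only [mem_insert, mem_singleton] at hvS
      rcases hvS with rfl | rfl
      · exact absurd hv ha
      · exact hv)
    (fun f hf => h2 f (mem_filter.1 hf).1)
  rw [card_erase_of_mem haV] at e3
  omega

lemma three_ne {e : Finset ℕ} (h : e.card = 3) : e.Nonempty := card_pos.1 (by omega)

/-- intersecting, no common vertex -/
lemma inter_bound {V : Finset ℕ} {H : Finset (Finset ℕ)} (hH : ThreeGraphOn V H)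
    (hi : ∀ e ∈ H, ∀ f ∈ H, ¬Disjoint e f) (hns : ∀ x, ∃ e ∈ H, x ∉ e) :
    H.card ≤ 27 ∨ H.card + 16 ≤ 5 * V.card := by
  by_cases hc : ∃ p q, ∀ e ∈ H, p ∈ e ∨ q ∈ e
  · right
    obtain ⟨p, q, hpq⟩ := hc
    obtain ⟨e, he, hpe⟩ := hns p
    obtain ⟨f, hf, hqf⟩ := hns q
    have hqe : q ∈ e := (hpq e he).resolve_left hpe
    have hpf : p ∈ f := (hpq f hf).resolve_right hqf
    have hne : p ≠ q := fun h => hpe (h ▸ hqe)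
    have hpV := (hH f hf).1 hpf
    have hqV := (hH e he).1 hqe
    have s1 := splitp (F := H) (p ∈ ·)
    have s2 := splitp (F := H.filter (p ∈ ·)) (q ∈ ·)
    have b1 := card_pr ((hH.filt (p ∈ ·)).filt (q ∈ ·)) hne (by
      intro f hf; simp only [mem_filter] at hf; exact ⟨hf.1.2, hf.2⟩)
    have b2 := card_star_hit2 (V := V.erase q) (p := p) (S := e.erase q)
      (((hH.filt (p ∈ ·)).filt (fun f => ¬ q ∈ f)).erase (q := q) (fun f hf => (mem_filter.1 hf).2))
      (mem_erase.2 ⟨hne, hpV⟩) (erase_subset_erase _ (hH e he).1) (by simp [hpe])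
      (by rw [card_erase_of_mem hqe, (hH e he).2]) (by
        intro f hf; simp only [mem_filter] at hf; exact hf.1.2) (by
        intro f hf
        simp only [mem_filter] at hf
        obtain ⟨v, hv, hve⟩ := not_disjoint_iff.1 (hi f hf.1.1 e he)
        exact not_disjoint_iff.2 ⟨v, hv, mem_erase.2 ⟨fun h => hf.2 (h ▸ hv), hve⟩⟩)
    have b3 := card_star_hit2 (V := V.erase p) (p := q) (S := f.erase p)
      ((hH.filt (fun f => ¬ p ∈ f)).erase (q := p) (fun f hf => (mem_filter.1 hf).2))
      (mem_erase.2 ⟨hne.symm, hqV⟩) (erase_subset_erase _ (hH f hf).1) (by simp [hqf])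
      (by rw [card_erase_of_mem hpf, (hH f hf).2]) (by
        intro f hf; simp only [mem_filter] at hf; exact (hpq f hf.1).resolve_left hf.2) (by
        intro g hg
        simp only [mem_filter] at hg
        obtain ⟨v, hv, hve⟩ := not_disjoint_iff.1 (hi g hg.1 f hf)
        exact not_disjoint_iff.2 ⟨v, hv, mem_erase.2 ⟨fun h => hg.2 (h ▸ hv), hve⟩⟩)
    rw [card_erase_of_mem hqV] at b2
    rw [card_erase_of_mem hpV] at b3
    omega
  · left
    push Not at hc
    obtain ⟨e, he, -⟩ := hns 0
    have := branch (F := H) (S := e) (k := 9) (fun f hf => hi f hf e he) (by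
      intro a _
      obtain ⟨f, hf, haf⟩ := hns a
      have := branch (F := H.filter (a ∈ ·)) (S := f) (k := 3)
        (fun g hg => hi g (mem_filter.1 hg).1 f hf) (by
          intro x hx
          obtain ⟨g, hg, hag, hxg⟩ := hc a x
          have := branch (F := (H.filter (a ∈ ·)).filter (x ∈ ·)) (S := g) (k := 1)
            (fun k hk => hi k (mem_filter.1 (mem_filter.1 hk).1).1 g hg) (by
              intro y hy
              refine card_trip (p := a) (q := x) (r := y) (((hH.filt _).filt _).filt _) ?_ ?_ ?_ ?_
              · exact fun h => haf (h ▸ hx)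
              · exact fun h => hag (h ▸ hy)
              · exact fun h => hxg (h ▸ hy)
              · intro f hf; simp only [mem_filter] at hf; tauto)
          rwa [(hH g hg).2] at this)
      rwa [(hH f hf).2] at this)
    rwa [(hH e he).2] at this

structure Dec (V : Finset ℕ) (D1 D2 R : Finset (Finset ℕ)) : Prop where
  t1 : ThreeGraphOn V D1
  t2 : ThreeGraphOn V D2
  tR : ThreeGraphOn V R
  ne1 : D1.Nonempty
  ne2 : D2.Nonempty
  dj : ∀ d ∈ D1, ∀ e ∈ D2, Disjoint d e
  h1 : ∀ r ∈ R, ∀ d ∈ D1, ¬Disjoint r d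
  h2 : ∀ r ∈ R, ∀ d ∈ D2, ¬Disjoint r d
  free : P4Free (D1 ∪ D2 ∪ R)

lemma Dec.swap {V : Finset ℕ} {D1 D2 R : Finset (Finset ℕ)} (h : Dec V D1 D2 R) :
    Dec V D2 D1 R :=
  ⟨h.t2, h.t1, h.tR, h.ne2, h.ne1, fun d hd e he => (h.dj e he d hd).symm, h.h2, h.h1,
    by rw [union_comm D2 D1]; exact h.free⟩

lemma Dec.card {V : Finset ℕ} {D1 D2 R : Finset (Finset ℕ)} (h : Dec V D1 D2 R) :
    (D1 ∪ D2 ∪ R).card = D1.card + D2.card + R.card := by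
  rw [card_union_of_disjoint, card_union_of_disjoint]
  · rw [disjoint_left]
    intro d h1 h2
    have := h.dj d h1 d h2
    exact (three_ne (h.t1 d h1).2).ne_empty (disjoint_self.1 this)
  · rw [disjoint_left]
    intro d hd hr
    obtain ⟨e1, he1⟩ := h.ne1
    obtain ⟨e2, he2⟩ := h.ne2
    rcases mem_union.1 hd with hd | hd
    · exact h.h2 d hr e2 he2 (h.dj d hd e2 he2)
    · exact h.h1 d hr e1 he1 (h.dj e1 he1 d hd).symm

lemma exists_dec {V : Finset ℕ} {H : Finset (Finset ℕ)} (hH : ThreeGraphOn V H) (hf : P4Free H)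
    (hd : ∃ e ∈ H, ∃ f ∈ H, Disjoint e f) :
    ∃ D1 D2 R, Dec V D1 D2 R ∧ H = D1 ∪ D2 ∪ R := by
  classical
  let P : Finset (Finset ℕ) × Finset (Finset ℕ) → Prop := fun D =>
    D.1.Nonempty ∧ D.2.Nonempty ∧ ∀ d ∈ D.1, ∀ e ∈ D.2, Disjoint d e
  have hne : ((H.powerset ×ˢ H.powerset).filter P).Nonempty := by
    obtain ⟨e, he, f, hf, hef⟩ := hd
    refine ⟨({e}, {f}), ?_⟩
    rw [mem_filter, mem_product, mem_powerset, mem_powerset]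
    refine ⟨⟨by simpa using he, by simpa using hf⟩, by simp, by simp, by simpa using hef⟩
  obtain ⟨⟨D1, D2⟩, hD, hmax⟩ := exists_max_image _ (fun D => (D.1 ∪ D.2).card) hne
  have hmax' : ∀ A B : Finset (Finset ℕ), A ⊆ H → B ⊆ H → A.Nonempty → B.Nonempty →
      (∀ d ∈ A, ∀ e ∈ B, Disjoint d e) → (A ∪ B).card ≤ (D1 ∪ D2).card := by
    intro A B hA hB h1 h2 h3
    exact hmax (A, B) (by
      rw [mem_filter, mem_product, mem_powerset, mem_powerset]
      exact ⟨⟨hA, hB⟩, h1, h2, h3⟩)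
  rw [mem_filter, mem_product, mem_powerset, mem_powerset] at hD
  obtain ⟨⟨hD1, hD2⟩, n1, n2, dj⟩ := hD
  simp only at hD1 hD2 n1 n2 dj
  clear hmax hne hd
  -- key claim
  have key : ∀ A B : Finset (Finset ℕ), A ⊆ H → B ⊆ H → A.Nonempty → B.Nonempty →
      (∀ d ∈ A, ∀ e ∈ B, Disjoint d e) → A ∪ B = D1 ∪ D2 →
      ∀ h ∈ H, h ∉ A ∪ B → ∀ c ∈ A, ¬Disjoint h c := by
    intro A B hA hB nA nB dj hAB h hh hhn c hc hhc
    have hcard : (A ∪ B).card < (insert h (A ∪ B)).card := by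
      rw [card_insert_of_notMem hhn]; omega
    -- h meets some d in B
    have hmeet : ∃ d ∈ B, ¬Disjoint h d := by
      by_contra hcon
      push Not at hcon
      have := hmax' (insert h A) B (insert_subset hh hA) hB (insert_nonempty _ _) nB (by
        intro d hd e he
        rcases mem_insert.1 hd with rfl | hd
        · exact hcon e he
        · exact dj d hd e he)
      rw [insert_union, ← hAB] at this
      omega
    obtain ⟨d, hd, hhd⟩ := hmeet
    by_cases hk : ∃ k0 ∈ A, ∃ k1 ∈ A, Disjoint h k0 ∧ ¬Disjoint h k1 ∧ ¬Disjoint k0 k1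
    · obtain ⟨k0, hk0, k1, hk1, e0, e1, e2⟩ := hk
      exact p4 hf (hA hk0) (hA hk1) hh (hB hd) e2 (fun h => e1 h.symm) hhd e0.symm
        (dj k0 hk0 d hd) (dj k1 hk1 d hd)
    · push Not at hk
      have := hmax' (A.filter (fun k => Disjoint h k)) (insert h (A.filter (fun k => ¬Disjoint h k) ∪ B))
        ((filter_subset _ _).trans hA)
        (insert_subset hh (union_subset ((filter_subset _ _).trans hA) hB))
        ⟨c, mem_filter.2 ⟨hc, hhc⟩⟩ (insert_nonempty _ _) (by
          intro k hk' e he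
          rw [mem_filter] at hk'
          rcases mem_insert.1 he with rfl | he
          · exact hk'.2.symm
          · rcases mem_union.1 he with he | he
            · rw [mem_filter] at he
              exact hk k hk'.1 e he.1 hk'.2 he.2
            · exact dj k hk'.1 e he)
      rw [union_insert, ← union_assoc, filter_union_filter_not_eq, ← hAB] at this
      omega
  refine ⟨D1, D2, H \ (D1 ∪ D2), ⟨hH.mono hD1, hH.mono hD2, hH.mono sdiff_subset, n1, n2, dj, ?_, ?_, ?_⟩, ?_⟩
  · intro r hr
    rw [mem_sdiff] at hr
    exact key D1 D2 hD1 hD2 n1 n2 dj rfl r hr.1 hr.2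
  · intro r hr
    rw [mem_sdiff] at hr
    exact key D2 D1 hD2 hD1 n2 n1 (fun d hd e he => (dj e he d hd).symm) (union_comm _ _) r hr.1
      (by rw [union_comm]; exact hr.2)
  · rw [union_sdiff_of_subset (union_subset hD1 hD2)]; exact hf
  · rw [union_sdiff_of_subset (union_subset hD1 hD2)]

/-- support -/
def supp (D : Finset (Finset ℕ)) : Finset ℕ := D.biUnion id

lemma mem_supp {D : Finset (Finset ℕ)} {v : ℕ} : v ∈ supp D ↔ ∃ d ∈ D, v ∈ d := by
  simp [supp]

lemma sub_supp {D : Finset (Finset ℕ)} {d : Finset ℕ} (hd : d ∈ D) : d ⊆ supp D :=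
  fun _ hv => mem_supp.2 ⟨d, hd, hv⟩

lemma ThreeGraphOn.on_supp {V : Finset ℕ} {D : Finset (Finset ℕ)} (h : ThreeGraphOn V D) :
    ThreeGraphOn (supp D) D := fun d hd => ⟨sub_supp hd, (h d hd).2⟩

lemma ThreeGraphOn.supp_sub {V : Finset ℕ} {D : Finset (Finset ℕ)} (h : ThreeGraphOn V D) :
    supp D ⊆ V := by
  intro v hv
  obtain ⟨d, hd, hv⟩ := mem_supp.1 hv
  exact (h d hd).1 hv

section
variable {V : Finset ℕ} {D1 D2 R : Finset (Finset ℕ)}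

lemma Dec.a3 (h : Dec V D1 D2 R) : 3 ≤ (supp D1).card := by
  obtain ⟨d, hd⟩ := h.ne1
  rw [← (h.t1 d hd).2]; exact card_le_card (sub_supp hd)

lemma Dec.sdj (h : Dec V D1 D2 R) : Disjoint (supp D1) (supp D2) := by
  rw [disjoint_left]
  intro v h1 h2
  obtain ⟨d, hd, hv⟩ := mem_supp.1 h1
  obtain ⟨e, he, hv'⟩ := mem_supp.1 h2
  exact disjoint_left.1 (h.dj d hd e he) hv hv'

lemma Dec.ab (h : Dec V D1 D2 R) : (supp D1).card + (supp D2).card ≤ V.card := by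
  rw [← card_union_of_disjoint h.sdj]
  exact card_le_card (union_subset h.t1.supp_sub h.t2.supp_sub)

lemma Dec.meet1 (h : Dec V D1 D2 R) {r d : Finset ℕ} (hr : r ∈ R) (hd : d ∈ D1) :
    ∃ v, v ∈ r ∧ v ∈ d := by
  obtain ⟨v, h1, h2⟩ := not_disjoint_iff.1 (h.h1 r hr d hd); exact ⟨v, h1, h2⟩

/-- If D2 has no common vertex, each r splits as 1+2 -/
lemma Dec.split (h : Dec V D1 D2 R) {r : Finset ℕ} (hr : r ∈ R) {d : Finset ℕ} (hd : d ∈ D2)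
    {v : ℕ} (hv : v ∈ r) (hvd : v ∈ supp D2) (hvn : v ∉ d) :
    ∃ p g, p ∈ supp D1 ∧ g ∈ d ∧ v ≠ g ∧ p ≠ v ∧ p ≠ g ∧ r = {p, v, g} ∧ r ∩ supp D2 = {v, g} := by
  obtain ⟨e, he⟩ := h.ne1
  obtain ⟨p, hpr, hpe⟩ := h.meet1 hr he
  obtain ⟨g, hgr, hgd⟩ := h.swap.meet1 hr hd
  have hp1 := sub_supp he hpe
  have hg2 := sub_supp hd hgd
  have hp2 := disjoint_left.1 h.sdj hp1
  have hvg : v ≠ g := fun h => hvn (h ▸ hgd)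
  have hpv : p ≠ v := fun h => hp2 (h ▸ hvd)
  have hpg : p ≠ g := fun h => hp2 (h ▸ hg2)
  have hreq : r = {p, v, g} := by
    symm
    apply eq_of_subset_of_card_le
    · intro x; simp only [mem_insert, mem_singleton]; rintro (rfl | rfl | rfl) <;> assumption
    · rw [(h.tR r hr).2, card_eq_three.2 ⟨p, v, g, hpv, hpg, hvg, rfl⟩]
  refine ⟨p, g, hp1, hgd, hvg, hpv, hpg, hreq, ?_⟩
  rw [hreq]
  ext x
  simp only [mem_inter, mem_insert, mem_singleton]
  constructor
  · rintro ⟨rfl | rfl | rfl, hx⟩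
    · exact absurd hx hp2
    · simp
    · simp
  · rintro (rfl | rfl)
    · exact ⟨by simp, hvd⟩
    · exact ⟨by simp, hg2⟩

end

def Poor (m k : ℕ) : Prop := (m = 7 ∧ k ≤ 27) ∨ (m = 8 ∧ k ≤ 35) ∨
  (9 ≤ m ∧ (k ≤ 38 ∨ k + 1 ≤ 4 * m ∨ k + 16 ≤ 5 * m))

/-- `G` is a family of pairs inside `W`, each pair meeting every member of `D`. -/
def PC (W : Finset ℕ) (D G : Finset (Finset ℕ)) : Prop :=
  ∀ g ∈ G, g.card = 2 ∧ g ⊆ W ∧ ∀ d ∈ D, ¬Disjoint g d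

lemma pair_eq {g : Finset ℕ} (h : g.card = 2) {u v : ℕ} (hu : u ∈ g) (hv : v ∈ g) (huv : u ≠ v) :
    g = {u, v} := by
  symm
  apply eq_of_subset_of_card_le
  · intro x; simp only [mem_insert, mem_singleton]; rintro (rfl | rfl) <;> assumption
  · rw [h, card_pair huv]

lemma trip_eq {g : Finset ℕ} (h : g.card = 3) {u v w : ℕ} (hu : u ∈ g) (hv : v ∈ g) (hw : w ∈ g)
    (huv : u ≠ v) (huw : u ≠ w) (hvw : v ≠ w) : g = {u, v, w} := by
  symm
  apply eq_of_subset_of_card_le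
  · intro x; simp only [mem_insert, mem_singleton]; rintro (rfl | rfl | rfl) <;> assumption
  · rw [h, card_eq_three.2 ⟨u, v, w, huv, huw, hvw, rfl⟩]

lemma pc_deg {W : Finset ℕ} {D G : Finset (Finset ℕ)} (h : PC W D G) {k : ℕ}
    (hk : ∀ d ∈ D, d.card = k) {v : ℕ} (hv : ∃ d ∈ D, v ∉ d) :
    (G.filter (v ∈ ·)).card ≤ k := by
  obtain ⟨d, hd, hvd⟩ := hv
  have : G.filter (v ∈ ·) ⊆ d.image (fun x => ({v, x} : Finset ℕ)) := by
    intro g hg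
    obtain ⟨hg, hvg⟩ := mem_filter.1 hg
    obtain ⟨x, hx, hxd⟩ := not_disjoint_iff.1 ((h g hg).2.2 d hd)
    rw [mem_image]
    exact ⟨x, hxd, (pair_eq (h g hg).1 hvg hx (fun h => hvd (h ▸ hxd))).symm⟩
  rw [← hk d hd]
  exact (card_le_card this).trans card_image_le

lemma pc_card {W : Finset ℕ} {D G : Finset (Finset ℕ)} (h : PC W D G) {k : ℕ}
    (hk : ∀ d ∈ D, d.card = k) (hne : D.Nonempty) (hv : ∀ v, ∃ d ∈ D, v ∉ d) :
    G.card ≤ k * k := by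
  obtain ⟨d, hd⟩ := hne
  have := branch (F := G) (S := d) (k := k) (fun g hg => (h g hg).2.2 d hd)
    (fun v _ => pc_deg h hk (hv v))
  rwa [hk d hd] at this

lemma pc_double {W : Finset ℕ} {D G : Finset (Finset ℕ)} (h : PC W D G) {k : ℕ}
    (hk : ∀ v ∈ W, (G.filter (v ∈ ·)).card ≤ k) : 2 * G.card ≤ k * W.card := by
  have h1 : ∑ g ∈ G, (W.filter (· ∈ g)).card = ∑ v ∈ W, (G.filter (v ∈ ·)).card :=
    sum_card_bipartiteAbove_eq_sum_card_bipartiteBelow (fun g v => v ∈ g)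
  have h2 : ∑ g ∈ G, (W.filter (· ∈ g)).card = 2 * G.card := by
    rw [mul_comm, ← smul_eq_mul]
    apply sum_const_nat
    intro g hg
    rw [filter_mem_eq_inter, inter_eq_right.2 (h g hg).2.1, (h g hg).1]
  have h3 : ∑ v ∈ W, (G.filter (v ∈ ·)).card ≤ W.card * k := by
    rw [← smul_eq_mul]; exact sum_le_card_nsmul _ _ _ hk
  rw [← h2, h1, mul_comm]; exact h3

lemma card_two_le {G : Finset (Finset ℕ)} (h2 : ∀ g ∈ G, g.card = 2) {u v : ℕ} (huv : u ≠ v)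
    (h : ∀ g ∈ G, u ∈ g ∧ v ∈ g) : G.card ≤ 1 := by
  rw [card_le_one]
  intro a ha b hb
  rw [pair_eq (h2 a ha) (h a ha).1 (h a ha).2 huv, pair_eq (h2 b hb) (h b hb).1 (h b hb).2 huv]

/-- intersecting pairs with max degree ≤ k ≤ 3 -/
lemma pairs_int {G : Finset (Finset ℕ)} (h2 : ∀ g ∈ G, g.card = 2)
    (hd : ∀ v, (G.filter (v ∈ ·)).card ≤ 3)
    (hi : ∀ g ∈ G, ∀ g' ∈ G, ¬Disjoint g g') : G.card ≤ 3 := by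
  by_cases hs : ∃ v, ∀ g ∈ G, v ∈ g
  · obtain ⟨v, hv⟩ := hs
    have := hd v
    rwa [filter_true_of_mem hv] at this
  push Not at hs
  obtain ⟨g0, hg0, -⟩ := hs 0
  obtain ⟨u, v, huv, rfl⟩ := card_eq_two.1 (h2 g0 hg0)
  obtain ⟨g1, hg1, hu1⟩ := hs u
  obtain ⟨g2, hg2, hv2⟩ := hs v
  have s1 := splitp (F := G) (u ∈ ·)
  have s2 := splitp (F := G.filter (u ∈ ·)) (v ∈ ·)
  have hv1 : v ∈ g1 := by
    have := hi g1 hg1 _ hg0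
    simp [hu1] at this; exact this
  have hu2 : u ∈ g2 := by
    have := hi g2 hg2 _ hg0
    simp [hv2] at this; exact this
  obtain ⟨w, hw1, hw2⟩ := not_disjoint_iff.1 (hi g1 hg1 g2 hg2)
  have hvw : v ≠ w := fun h => hv2 (h ▸ hw2)
  have huw : u ≠ w := fun h => hu1 (h ▸ hw1)
  have e1 := pair_eq (h2 g1 hg1) hv1 hw1 hvw
  have e2 := pair_eq (h2 g2 hg2) hu2 hw2 huw
  subst e1 e2
  have b1 := card_two_le (G := (G.filter (u ∈ ·)).filter (v ∈ ·)) (by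
    intro g hg; simp only [mem_filter] at hg; exact h2 g hg.1.1) huv (by
    intro g hg; simp only [mem_filter] at hg; exact ⟨hg.1.2, hg.2⟩)
  have b2 := card_two_le (G := (G.filter (u ∈ ·)).filter (fun g => ¬ v ∈ g)) (by
    intro g hg; simp only [mem_filter] at hg; exact h2 g hg.1.1) huw (by
    intro g hg; simp only [mem_filter] at hg
    refine ⟨hg.1.2, ?_⟩
    have := hi g hg.1.1 _ hg1
    simp [hg.2] at this; exact this)
  have b3 := card_two_le (G := G.filter (fun g => ¬ u ∈ g)) (by
    intro g hg; simp only [mem_filter] at hg; exact h2 g hg.1) hvw (by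
    intro g hg; simp only [mem_filter] at hg
    have t1 := hi g hg.1 _ hg0
    have t2 := hi g hg.1 _ hg2
    simp [hg.2] at t1 t2; exact ⟨t1, t2⟩)
  omega

section
variable {V : Finset ℕ} {D1 D2 R : Finset (Finset ℕ)}

/-- common vertices -/
def com (D : Finset (Finset ℕ)) : Finset ℕ := (supp D).filter (fun v => ∀ d ∈ D, v ∈ d)

lemma mem_com {D : Finset (Finset ℕ)} (hD : D.Nonempty) {v : ℕ} : v ∈ com D ↔ ∀ d ∈ D, v ∈ d := by
  unfold com
  rw [mem_filter]
  refine ⟨fun h => h.2, fun h => ⟨?_, h⟩⟩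
  obtain ⟨d, hd⟩ := hD
  exact sub_supp hd (h d hd)

lemma com_sub {D : Finset (Finset ℕ)} {d : Finset ℕ} (hd : d ∈ D) : com D ⊆ d := by
  intro v hv
  exact (mem_filter.1 hv).2 d hd

lemma com_le {D : Finset (Finset ℕ)} (hD : D.Nonempty) (t : ThreeGraphOn V D) : (com D).card ≤ 3 := by
  obtain ⟨d, hd⟩ := hD
  rw [← (t d hd).2]
  exact card_le_card (com_sub hd)

lemma com_single {D : Finset (Finset ℕ)} (hD : D.Nonempty) (t : ThreeGraphOn V D)
    (h : 3 ≤ (com D).card) : ∃ d, D = {d} ∧ com D = d ∧ d.card = 3 := by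
  obtain ⟨d, hd⟩ := hD
  refine ⟨d, ?_, ?_, (t d hd).2⟩
  · ext e
    rw [mem_singleton]
    constructor
    · intro he
      have h1 := eq_of_subset_of_card_le (com_sub he) (by rw [(t e he).2]; exact h)
      have h2 := eq_of_subset_of_card_le (com_sub hd) (by rw [(t d hd).2]; exact h)
      rw [← h1, h2]
    · rintro rfl; exact hd
  · exact eq_of_subset_of_card_le (com_sub hd) (by rw [(t d hd).2]; exact h)

lemma supp_four {D : Finset (Finset ℕ)} (t : ThreeGraphOn V D) (h : 2 ≤ D.card) :
    4 ≤ (supp D).card := by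
  by_contra hc
  have := card_all t.on_supp
  have h3 : (supp D).card.choose 3 ≤ (3 : ℕ).choose 3 := Nat.choose_le_choose 3 (by omega)
  simp at h3; omega

lemma card_of_com2 {D : Finset (Finset ℕ)} (hD : D.Nonempty) (t : ThreeGraphOn V D)
    (h : 2 ≤ (com D).card) : D.card + 2 ≤ (supp D).card := by
  obtain ⟨p, hp, q, hq, hpq⟩ := one_lt_card.1 h
  have := card_pr t.on_supp hpq (fun d hd => ⟨com_sub hd hp, com_sub hd hq⟩)
  obtain ⟨d, hd⟩ := hD
  have := card_le_card (sub_supp hd)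
  rw [(t d hd).2] at this
  omega

lemma Dec.gam (h : Dec V D1 D2 R) {r : Finset ℕ} (hr : r ∈ R)
    (hnc : ∀ v ∈ r, v ∈ supp D2 → ∃ d ∈ D2, v ∉ d) :
    ∃ p ∈ com D1, ∃ g : Finset ℕ, g.card = 2 ∧ g ⊆ supp D2 ∧ (∀ d ∈ D2, ¬Disjoint g d) ∧
      r = insert p g ∧ r ∩ supp D2 = g ∧ g ⊆ r := by
  obtain ⟨d0, hd0⟩ := h.ne2
  obtain ⟨v, hvr, hvd⟩ := h.swap.meet1 hr hd0
  have hv2 := sub_supp hd0 hvd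
  obtain ⟨d, hd, hvn⟩ := hnc v hvr hv2
  obtain ⟨p, g, hp, hg, hvg, hpv, hpg, hreq, hri⟩ := h.split hr hd hvr hv2 hvn
  have hg2 := sub_supp hd hg
  refine ⟨p, ?_, {v, g}, card_pair hvg, ?_, ?_, hreq, hri, ?_⟩
  · rw [mem_com h.ne1]
    intro e he
    obtain ⟨x, hx, hxe⟩ := h.meet1 hr he
    have hx1 := disjoint_left.1 h.sdj (sub_supp he hxe)
    rw [hreq] at hx
    simp only [mem_insert, mem_singleton] at hx
    rcases hx with rfl | rfl | rfl
    · exact hxe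
    · exact absurd hv2 hx1
    · exact absurd hg2 hx1
  · intro x; simp only [mem_insert, mem_singleton]; rintro (rfl | rfl) <;> assumption
  · intro e he
    rw [← hri]
    obtain ⟨x, hx, hxe⟩ := h.swap.meet1 hr he
    exact not_disjoint_iff.2 ⟨x, mem_inter.2 ⟨hx, sub_supp he hxe⟩, hxe⟩
  · rw [← hri]; exact inter_subset_left

lemma Dec.gamma (h : Dec V D1 D2 R) {B : Finset (Finset ℕ)} (hB : B ⊆ R)
    (hnc : ∀ r ∈ B, ∀ v ∈ r, v ∈ supp D2 → ∃ d ∈ D2, v ∉ d) :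
    ∃ G, PC (supp D2) D2 G ∧ B.card ≤ (com D1).card * G.card ∧ (∀ g ∈ G, ∃ r ∈ B, g ⊆ r) := by
  refine ⟨B.image (· ∩ supp D2), ?_, ?_, ?_⟩
  · intro g hg
    obtain ⟨r, hr, rfl⟩ := mem_image.1 hg
    obtain ⟨p, hp, g, h1, h2, h3, h4, h5, h6⟩ := h.gam (hB hr) (hnc r hr)
    simp only [h5]
    exact ⟨h1, h2, h3⟩
  · rw [← card_product]
    have : B ⊆ ((com D1) ×ˢ (B.image (· ∩ supp D2))).image (fun x => insert x.1 x.2) := by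
      intro r hr
      obtain ⟨p, hp, g, h1, h2, h3, h4, h5, h6⟩ := h.gam (hB hr) (hnc r hr)
      rw [mem_image]
      refine ⟨(p, g), mem_product.2 ⟨hp, mem_image.2 ⟨r, hr, h5⟩⟩, h4.symm⟩
    exact (card_le_card this).trans card_image_le
  · intro g hg
    obtain ⟨r, hr, rfl⟩ := mem_image.1 hg
    exact ⟨r, hr, inter_subset_left⟩

/-- Case I : D2 not a star -/
lemma Dec.case1 (h : Dec V D1 D2 R) (hns : ∀ v, ∃ d ∈ D2, v ∉ d) (hm : 7 ≤ V.card)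
    (hR : 10 ≤ R.card) : Poor V.card (D1.card + D2.card + R.card) := by
  obtain ⟨G, hG, hRG, -⟩ := h.gamma (B := R) le_rfl (fun r _ v _ _ => hns v)
  have hk : ∀ d ∈ D2, d.card = 3 := fun d hd => (h.t2 d hd).2
  have hdeg : ∀ v, (G.filter (v ∈ ·)).card ≤ 3 := fun v => pc_deg hG hk (hns v)
  have ht9 := pc_card hG hk h.ne2 hns
  have ht2 := pc_double hG (fun v _ => hdeg v)
  have hc3 := com_le h.ne1 h.t1
  have hab := h.ab
  have ha3 := h.a3
  have hc2 : 2 ≤ (com D1).card := by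
    by_contra hc
    have : (com D1).card * G.card ≤ 1 * G.card := Nat.mul_le_mul_right _ (by omega)
    omega
  have ht4 : 4 ≤ G.card := by
    by_contra hc
    have : (com D1).card * G.card ≤ 3 * 3 := Nat.mul_le_mul hc3 (by omega)
    omega
  have hD1 := card_of_com2 h.ne1 h.t1 hc2
  have hD2 : D2.card + 12 ≤ 4 * (supp D2).card := by
    have : ∃ g ∈ G, ∃ g' ∈ G, Disjoint g g' := by
      by_contra hcon
      push Not at hcon
      have := pairs_int (fun g hg => (hG g hg).1) hdeg hcon
      omega
    obtain ⟨g, hg, g', hg', hdj⟩ := this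
    exact card_hit22 h.t2.on_supp (hG g hg).2.1 (hG g' hg').2.1 (hG g hg).1 (hG g' hg').1 hdj
      (fun d hd hh => (hG g hg).2.2 d hd hh.symm) (fun d hd hh => (hG g' hg').2.2 d hd hh.symm)
  have hb4 : 4 ≤ (supp D2).card := by
    apply supp_four h.t2
    by_contra hc
    obtain ⟨d, hd⟩ := h.ne2
    obtain ⟨v, hv⟩ := three_ne (hk d hd)
    obtain ⟨e, he, hve⟩ := hns v
    have := card_le_one.1 (by omega : D2.card ≤ 1) d hd e he
    exact hve (this ▸ hv)
  unfold Poor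
  by_cases hc : (com D1).card = 2
  · rw [hc] at hRG
    have ha4 : 4 ≤ (supp D1).card := by
      apply supp_four h.t1
      by_contra hcc
      obtain ⟨d, hd⟩ := h.ne1
      have hd1 : D1 = {d} := eq_singleton_iff_unique_mem.2 ⟨hd, fun e he => card_le_one.1 (by omega) e he d hd⟩
      have : d ⊆ com D1 := by
        intro v hv
        rw [mem_com h.ne1, hd1]; simpa using hv
      have := card_le_card this
      rw [(h.t1 d hd).2] at this
      omega
    omega
  · have hc' : (com D1).card = 3 := by omega
    rw [hc'] at hRG
    obtain ⟨d, hd1, -, hd3⟩ := com_single h.ne1 h.t1 (by omega)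
    have hD1' : D1.card = 1 := by rw [hd1]; simp
    by_cases ht : G.card ≤ 7
    · omega
    · have h8 : D2.card ≤ 8 := by
        have cov : ∀ g ∈ G, ∀ d ∈ D2, ¬Disjoint d g := fun g hg d hd hh => (hG g hg).2.2 d hd hh.symm
        obtain ⟨g, hg⟩ := card_pos.1 (by omega : 0 < G.card)
        have := branch (F := D2) (S := g) (k := 4) (cov g hg) (by
          intro u hu
          have : ∃ g ∈ G, u ∉ g := by
            by_contra hcon
            push Not at hcon
            have := hdeg u
            rw [filter_true_of_mem hcon] at this
            omega
          obtain ⟨g1, hg1, hu1⟩ := this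
          have := branch (F := D2.filter (u ∈ ·)) (S := g1) (k := 2)
            (fun d hd => cov g1 hg1 d (mem_filter.1 hd).1) (by
            intro v hv
            have : ∃ g ∈ G, u ∉ g ∧ v ∉ g := by
              by_contra hcon
              push Not at hcon
              have h1 := splitp (F := G) (u ∈ ·)
              have h2 : (G.filter (fun g => ¬ u ∈ g)).card ≤ (G.filter (v ∈ ·)).card := by
                apply card_le_card
                intro g hg
                rw [mem_filter] at hg ⊢
                exact ⟨hg.1, hcon g hg.1 hg.2⟩
              have := hdeg u
              have := hdeg v
              omega
            obtain ⟨g2, hg2, hu2, hv2⟩ := this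
            have := branch (F := (D2.filter (u ∈ ·)).filter (v ∈ ·)) (S := g2) (k := 1)
              (fun d hd => cov g2 hg2 d (mem_filter.1 (mem_filter.1 hd).1).1) (by
                intro w hw
                refine card_trip (p := u) (q := v) (r := w) (((h.t2.filt _).filt _).filt _) ?_ ?_ ?_ ?_
                · exact fun h => hu1 (h ▸ hv)
                · exact fun h => hu2 (h ▸ hw)
                · exact fun h => hv2 (h ▸ hw)
                · intro f hf; simp only [mem_filter] at hf; tauto)
            rwa [(hG g2 hg2).1] at this)
          rwa [(hG g1 hg1).1] at this)
        rwa [(hG g hg).1] at this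
      omega

end

section
variable {V : Finset ℕ} {D1 D2 R : Finset (Finset ℕ)}

lemma Dec.c1gam (h : Dec V D1 D2 R) {q : ℕ} (hq : com D2 = {q}) :
    ∃ G, PC (supp D2) D2 G ∧ (∀ g ∈ G, q ∉ g) ∧
      (R.filter (fun r => ¬ q ∈ r)).card ≤ (com D1).card * G.card ∧
      (∀ v, (G.filter (v ∈ ·)).card ≤ 2) ∧ G.card ≤ 4 := by
  have hav : ∀ v, v ≠ q → ∃ d ∈ D2, v ∉ d := by
    intro v hv
    have : v ∉ com D2 := by rw [hq]; simpa using hv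
    rw [mem_com h.ne2] at this
    push Not at this
    exact this
  have hqd : ∀ d ∈ D2, q ∈ d := fun d hd => com_sub hd (by simp [hq])
  obtain ⟨G, hG, h1, h2⟩ := h.gamma (B := R.filter (fun r => ¬ q ∈ r)) (filter_subset _ _) (by
    intro r hr v hv _
    apply hav
    rintro rfl
    exact (mem_filter.1 hr).2 hv)
  have hqG : ∀ g ∈ G, q ∉ g := by
    intro g hg hqg
    obtain ⟨r, hr, hgr⟩ := h2 g hg
    exact (mem_filter.1 hr).2 (hgr hqg)
  have hG' : PC (supp D2) (D2.image (fun d => d.erase q)) G := by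
    intro g hg
    refine ⟨(hG g hg).1, (hG g hg).2.1, ?_⟩
    intro d' hd'
    obtain ⟨d, hd, rfl⟩ := mem_image.1 hd'
    obtain ⟨x, hx, hxd⟩ := not_disjoint_iff.1 ((hG g hg).2.2 d hd)
    exact not_disjoint_iff.2 ⟨x, hx, mem_erase.2 ⟨fun h => hqG g hg (h ▸ hx), hxd⟩⟩
  have hk : ∀ d ∈ D2.image (fun d => d.erase q), d.card = 2 := by
    intro d' hd'
    obtain ⟨d, hd, rfl⟩ := mem_image.1 hd'
    rw [card_erase_of_mem (hqd d hd), (h.t2 d hd).2]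
  have hv : ∀ v, ∃ d ∈ D2.image (fun d => d.erase q), v ∉ d := by
    intro v
    by_cases hvq : v = q
    · obtain ⟨d, hd⟩ := h.ne2
      exact ⟨d.erase q, mem_image_of_mem _ hd, by simp [hvq]⟩
    · obtain ⟨d, hd, hvd⟩ := hav v hvq
      exact ⟨d.erase q, mem_image_of_mem _ hd, by simp [hvd]⟩
  exact ⟨G, hG, hqG, h1, fun v => pc_deg hG' hk (hv v), pc_card hG' hk (h.ne2.image _) hv⟩

lemma Dec.c1two (h : Dec V D1 D2 R) (h3 : (com D2).card < 3) : 2 ≤ D2.card := by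
  by_contra hcc
  obtain ⟨d, hd⟩ := h.ne2
  have hd1 : D2 = {d} := eq_singleton_iff_unique_mem.2 ⟨hd, fun e he => card_le_one.1 (by omega) e he d hd⟩
  have : d ⊆ com D2 := by
    intro v hv
    rw [mem_com h.ne2, hd1]; simpa using hv
  have := card_le_card this
  rw [(h.t2 d hd).2] at this
  omega

lemma Dec.c1bound (h : Dec V D1 D2 R) {q : ℕ} (hq : com D2 = {q}) {g : Finset ℕ}
    {G : Finset (Finset ℕ)} (hG : PC (supp D2) D2 G) (hg : g ∈ G) (hqg : q ∉ g) :
    D2.card + 5 ≤ 2 * (supp D2).card := by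
  have hqd : ∀ d ∈ D2, q ∈ d := fun d hd => com_sub hd (by simp [hq])
  refine card_star_hit2 h.t2.on_supp (p := q) (S := g) ?_ (hG g hg).2.1 hqg (hG g hg).1 hqd
    (fun d hd hh => (hG g hg).2.2 d hd hh.symm)
  obtain ⟨d, hd⟩ := h.ne2
  exact sub_supp hd (hqd d hd)

lemma Dec.c11 (h : Dec V D1 D2 R) {p q : ℕ} (hp : com D1 = {p}) (hq : com D2 = {q})
    (hB : ∃ r ∈ R, q ∉ r) (hB' : ∃ r ∈ R, p ∉ r) :
    Poor V.card (D1.card + D2.card + R.card) := by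
  obtain ⟨G, hG, hqG, hb, -, h4⟩ := h.c1gam hq
  obtain ⟨G', hG', hqG', hb', -, h4'⟩ := h.swap.c1gam hp
  rw [hp] at hb
  rw [hq] at hb'
  simp only [card_singleton, one_mul] at hb hb'
  obtain ⟨r, hr, hqr⟩ := hB
  obtain ⟨r', hr', hpr'⟩ := hB'
  have h1 : 0 < (R.filter (fun r => ¬ q ∈ r)).card := card_pos.2 ⟨r, mem_filter.2 ⟨hr, hqr⟩⟩
  have h2 : 0 < (R.filter (fun r => ¬ p ∈ r)).card := card_pos.2 ⟨r', mem_filter.2 ⟨hr', hpr'⟩⟩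
  obtain ⟨g, hg⟩ := card_pos.1 (by omega : 0 < G.card)
  obtain ⟨g', hg'⟩ := card_pos.1 (by omega : 0 < G'.card)
  have e1 := h.c1bound hq hG hg (hqG g hg)
  have e2 := h.swap.c1bound hp hG' hg' (hqG' g' hg')
  have s1 := splitp (F := R) (q ∈ ·)
  have s2 := splitp (F := R.filter (q ∈ ·)) (p ∈ ·)
  have s3 : ((R.filter (q ∈ ·)).filter (fun r => ¬ p ∈ r)).card ≤ (R.filter (fun r => ¬ p ∈ r)).card :=
    card_le_card (filter_subset_filter _ (filter_subset _ _))
  have hpq : q ≠ p := by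
    rintro rfl
    have h1 : q ∈ com D1 := by simp [hp]
    have h2 : q ∈ com D2 := by simp [hq]
    exact disjoint_left.1 h.sdj (mem_filter.1 h1).1 (mem_filter.1 h2).1
  have s4 := card_pr ((h.tR.filt (q ∈ ·)).filt (p ∈ ·)) hpq (by
    intro f hf; simp only [mem_filter] at hf; exact ⟨hf.1.2, hf.2⟩)
  have a4 := supp_four h.t1 (h.swap.c1two (by rw [hp]; simp))
  have b4 := supp_four h.t2 (h.c1two (by rw [hq]; simp))
  have := h.ab
  unfold Poor
  omega

lemma Dec.c31 (h : Dec V D1 D2 R) {q : ℕ} (hp : 3 ≤ (com D1).card) (hq : com D2 = {q})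
    (hB : ∃ r ∈ R, q ∉ r) (hm : 7 ≤ V.card) :
    Poor V.card (D1.card + D2.card + R.card) := by
  obtain ⟨e, hD1, hce, he3⟩ := com_single h.ne1 h.t1 hp
  obtain ⟨G, hG, hqG, hb, hdeg, h4⟩ := h.c1gam hq
  rw [hce, he3] at hb
  obtain ⟨r, hr, hqr⟩ := hB
  have h1 : 0 < (R.filter (fun r => ¬ q ∈ r)).card := card_pos.2 ⟨r, mem_filter.2 ⟨hr, hqr⟩⟩
  obtain ⟨g, hg⟩ := card_pos.1 (by omega : 0 < G.card)
  have e1 := h.c1bound hq hG hg (hqG g hg)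
  have s1 := splitp (F := R) (q ∈ ·)
  have hqs : q ∈ supp D2 := by
    have h2 : q ∈ com D2 := by simp [hq]
    exact (mem_filter.1 h2).1
  have hqe : q ∉ e := by
    intro hqe
    exact disjoint_right.1 h.sdj hqs (sub_supp (by simp [hD1]) hqe)
  have heD : e ∈ D1 := by simp [hD1]
  have hA := card_star_hit3 (h.tR.filt (q ∈ ·)) (p := q) (S := e) (h.t2.supp_sub hqs) (h.t1 e heD).1
    hqe he3 (fun f hf => (mem_filter.1 hf).2) (fun f hf => h.h1 f (mem_filter.1 hf).1 e heD)
  have hD1c : D1.card = 1 := by rw [hD1]; simp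
  have b4 := supp_four h.t2 (h.c1two (by rw [hq]; simp))
  have hab := h.ab
  have ha := h.a3
  have hqd : ∀ d ∈ D2, q ∈ d := fun d hd => com_sub hd (by simp [hq])
  have cov : ∀ g ∈ G, ∀ d ∈ D2, ¬Disjoint d g := fun g hg d hd hh => (hG g hg).2.2 d hd hh.symm
  unfold Poor
  by_cases ht : G.card ≤ 1
  · omega
  by_cases hdj : ∃ g ∈ G, ∃ g' ∈ G, Disjoint g g'
  · obtain ⟨g, hg, g', hg', hgg⟩ := hdj
    have hb5 : 5 ≤ (supp D2).card := by
      have : insert q (g ∪ g') ⊆ supp D2 :=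
        insert_subset hqs (union_subset (hG g hg).2.1 (hG g' hg').2.1)
      have := card_le_card this
      rwa [card_insert_of_notMem (by
        rw [mem_union]; rintro (h | h)
        · exact hqG g hg h
        · exact hqG g' hg' h), card_union_of_disjoint hgg, (hG g hg).1, (hG g' hg').1] at this
    have : D2.card ≤ g.card * 2 := branch (cov g hg) (by
      intro v hv
      have := branch (F := D2.filter (v ∈ ·)) (S := g') (k := 1)
        (fun d hd => cov g' hg' d (mem_filter.1 hd).1) (by
          intro w hw
          refine card_trip (p := q) (q := v) (r := w) ((h.t2.filt _).filt _) ?_ ?_ ?_ ?_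
          · exact fun h => hqG g hg (h ▸ hv)
          · exact fun h => hqG g' hg' (h ▸ hw)
          · exact fun h => disjoint_left.1 hgg hv (h ▸ hw)
          · intro f hf; simp only [mem_filter] at hf; exact ⟨hqd f hf.1.1, hf.1.2, hf.2⟩)
      rwa [(hG g' hg').1] at this)
    rw [(hG g hg).1] at this
    omega
  · push Not at hdj
    have ht3 := pairs_int (fun g hg => (hG g hg).1) (fun v => (hdeg v).trans (by omega)) hdj
    obtain ⟨g, hg, g', hg', hne⟩ := one_lt_card.1 (by omega : 1 < G.card)
    obtain ⟨x, hx, hx'⟩ := not_disjoint_iff.1 (hdj g hg g' hg')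
    have hqx : q ≠ x := fun h => hqG g hg (h ▸ hx)
    have hD2 : D2.card + 1 ≤ (supp D2).card := by
      have s1 := splitp (F := D2) (x ∈ ·)
      have s2 := card_pr (h.t2.on_supp.filt (x ∈ ·)) hqx (by
        intro f hf; rw [mem_filter] at hf; exact ⟨hqd f hf.1, hf.2⟩)
      have : ∃ y ∈ g, y ≠ x := by
        apply exists_mem_ne; rw [(hG g hg).1]; omega
      obtain ⟨y, hy, hyx⟩ := this
      have : ∃ y ∈ g', y ≠ x := by
        apply exists_mem_ne; rw [(hG g' hg').1]; omega
      obtain ⟨y', hy', hyx'⟩ := this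
      have eg := pair_eq (hG g hg).1 hx hy hyx.symm
      have eg' := pair_eq (hG g' hg').1 hx' hy' hyx'.symm
      have hyy : y ≠ y' := by
        rintro rfl; exact hne (eg.trans eg'.symm)
      have s3 : (D2.filter (fun f => ¬ x ∈ f)).card ≤ 1 := by
        refine card_trip (p := q) (q := y) (r := y') (h.t2.filt _) ?_ ?_ hyy ?_
        · exact fun h => hqG g hg (h ▸ hy)
        · exact fun h => hqG g' hg' (h ▸ hy')
        · intro f hf
          rw [mem_filter] at hf
          have c1 := cov g hg f hf.1
          have c2 := cov g' hg' f hf.1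
          rw [eg] at c1
          rw [eg'] at c2
          simp [hf.2] at c1 c2
          exact ⟨hqd f hf.1, c1, c2⟩
      omega
    omega

/-- third vertex in a pair-type family -/
lemma pair_third {D : Finset (Finset ℕ)} (t : ThreeGraphOn V D) {p p' : ℕ} (hpp : p ≠ p')
    {d : Finset ℕ} (hd : d ∈ D) (hp : p ∈ d) (hp' : p' ∈ d) :
    ∃ w, w ≠ p ∧ w ≠ p' ∧ d = {p, p', w} := by
  have h1 : ({p, p'} : Finset ℕ) ⊆ d := by
    intro x; simp only [mem_insert, mem_singleton]; rintro (rfl | rfl) <;> assumption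
  have h2 : (d \ {p, p'}).Nonempty := by
    apply card_pos.1
    rw [card_sdiff_of_subset h1, (t d hd).2, card_pair hpp]; omega
  obtain ⟨w, hw⟩ := h2
  simp only [mem_sdiff, mem_insert, mem_singleton, not_or] at hw
  exact ⟨w, hw.2.1, hw.2.2, trip_eq (t d hd).2 hp hp' hw.1 hpp (Ne.symm hw.2.1) (Ne.symm hw.2.2)⟩

lemma Dec.third_mem (h : Dec V D1 D2 R) {p p' w : ℕ} (hd : {p, p', w} ∈ D1) {r : Finset ℕ}
    (hr : r ∈ R) (hpr : p ∉ r) (hpr' : p' ∉ r) : w ∈ r := by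
  obtain ⟨v, hv, hvd⟩ := h.meet1 hr hd
  simp only [mem_insert, mem_singleton] at hvd
  rcases hvd with rfl | rfl | rfl
  · exact absurd hv hpr
  · exact absurd hv hpr'
  · exact hv

lemma Dec.pair_miss (h : Dec V D1 D2 R) {p p' q : ℕ} (hpp : p ≠ p') (hp : p ∈ com D1)
    (hp' : p' ∈ com D1) (hq : q ∉ supp D1) (h2 : 2 ≤ D1.card) :
    (R.filter (fun r => q ∈ r ∧ p ∉ r ∧ p' ∉ r)).card ≤ 1 ∧
    (3 ≤ D1.card → (R.filter (fun r => q ∈ r ∧ p ∉ r ∧ p' ∉ r)).card = 0) := by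
  constructor
  · obtain ⟨d, hd, d', hd', hne⟩ := one_lt_card.1 h2
    obtain ⟨w, hw1, hw2, rfl⟩ := pair_third h.t1 hpp hd (com_sub hd hp) (com_sub hd hp')
    obtain ⟨w', hw1', hw2', rfl⟩ := pair_third h.t1 hpp hd' (com_sub hd' hp) (com_sub hd' hp')
    refine card_trip (p := q) (q := w) (r := w') (h.tR.filt _) ?_ ?_ ?_ ?_
    · exact fun h => hq (sub_supp hd (by simp [h]))
    · exact fun h => hq (sub_supp hd' (by simp [h]))
    · rintro rfl; exact hne rfl
    · intro r hr
      obtain ⟨hr, h1, h2, h3⟩ := mem_filter.1 hr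
      exact ⟨h1, h.third_mem hd hr h2 h3, h.third_mem hd' hr h2 h3⟩
  · intro h3
    obtain ⟨d, hd, d', hd', d'', hd'', n1, n2, n3⟩ := two_lt_card.1 h3
    obtain ⟨w, hw1, hw2, rfl⟩ := pair_third h.t1 hpp hd (com_sub hd hp) (com_sub hd hp')
    obtain ⟨w', hw1', hw2', rfl⟩ := pair_third h.t1 hpp hd' (com_sub hd' hp) (com_sub hd' hp')
    obtain ⟨w'', hw1'', hw2'', rfl⟩ := pair_third h.t1 hpp hd'' (com_sub hd'' hp) (com_sub hd'' hp')
    rw [card_eq_zero, filter_eq_empty_iff]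
    rintro r hr ⟨h1, h2, h3⟩
    have m1 := h.third_mem hd hr h2 h3
    have m2 := h.third_mem hd' hr h2 h3
    have m3 := h.third_mem hd'' hr h2 h3
    have e := trip_eq (h.tR r hr).2 m1 m2 m3 (by rintro rfl; exact n1 rfl)
      (by rintro rfl; exact n2 rfl) (by rintro rfl; exact n3 rfl)
    rw [e] at h1
    simp only [mem_insert, mem_singleton] at h1
    rcases h1 with rfl | rfl | rfl
    · exact hq (sub_supp hd (by simp))
    · exact hq (sub_supp hd' (by simp))
    · exact hq (sub_supp hd'' (by simp))

lemma Dec.Rq_bound (h : Dec V D1 D2 R) {p p' q : ℕ} (hpp : p ≠ p') (hp : p ∈ com D1)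
    (hp' : p' ∈ com D1) (hq : q ∈ supp D2) (h2 : 2 ≤ D1.card) :
    (R.filter (q ∈ ·)).card + 4 ≤ 2 * V.card ∧ (3 ≤ D1.card → (R.filter (q ∈ ·)).card + 5 ≤ 2 * V.card) := by
  have hq1 := disjoint_right.1 h.sdj hq
  obtain ⟨e1, e2⟩ := h.pair_miss hpp hp hp' hq1 h2
  have s := splitp (F := R.filter (q ∈ ·)) (fun r => ¬Disjoint r {p, p'})
  have e3 : ((R.filter (q ∈ ·)).filter (fun r => ¬¬Disjoint r {p, p'})).card ≤
      (R.filter (fun r => q ∈ r ∧ p ∉ r ∧ p' ∉ r)).card := by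
    apply card_le_card
    intro r hr
    simp only [mem_filter, not_not, disjoint_insert_right, disjoint_singleton_right] at hr ⊢
    tauto
  have hpV : p ∈ V := h.t1.supp_sub (mem_filter.1 hp).1
  have hpV' : p' ∈ V := h.t1.supp_sub (mem_filter.1 hp').1
  have e4 := card_star_hit2 (S := {p, p'}) (p := q) ((h.tR.filt (q ∈ ·)).filt (fun r => ¬Disjoint r {p, p'}))
    (h.t2.supp_sub hq) (by
      intro x; simp only [mem_insert, mem_singleton]; rintro (rfl | rfl) <;> assumption) (by
      simp only [mem_insert, mem_singleton, not_or]
      exact ⟨fun h => hq1 (h ▸ (mem_filter.1 hp).1), fun h => hq1 (h ▸ (mem_filter.1 hp').1)⟩)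
    (card_pair hpp) (by
      intro f hf; simp only [mem_filter] at hf; exact hf.1.2) (by
      intro f hf; rw [mem_filter] at hf; exact hf.2)
  constructor
  · omega
  · intro h3
    have := e2 h3
    omega

lemma Dec.c21 (h : Dec V D1 D2 R) {q : ℕ} (hp : (com D1).card = 2) (hq : com D2 = {q})
    (hB : ∃ r ∈ R, q ∉ r) :
    Poor V.card (D1.card + D2.card + R.card) := by
  obtain ⟨G, hG, hqG, hb, hdeg, h4⟩ := h.c1gam hq
  rw [hp] at hb
  obtain ⟨r, hr, hqr⟩ := hB
  have h1 : 0 < (R.filter (fun r => ¬ q ∈ r)).card := card_pos.2 ⟨r, mem_filter.2 ⟨hr, hqr⟩⟩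
  obtain ⟨g, hg⟩ := card_pos.1 (by omega : 0 < G.card)
  have e1 := h.c1bound hq hG hg (hqG g hg)
  have s1 := splitp (F := R) (q ∈ ·)
  have hqs : q ∈ supp D2 := by
    have h2 : q ∈ com D2 := by simp [hq]
    exact (mem_filter.1 h2).1
  have a2 := h.swap.c1two (by omega)
  have a4 := supp_four h.t1 a2
  have b4 := supp_four h.t2 (h.c1two (by rw [hq]; simp))
  have hab := h.ab
  have e2 := card_of_com2 h.ne1 h.t1 (by omega)
  obtain ⟨p, p', hpp, hpe⟩ := card_eq_two.1 hp
  have e3 := (h.Rq_bound hpp (by simp [hpe]) (by simp [hpe]) hqs a2).1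
  unfold Poor
  omega
end

def cpl (A B : Finset ℕ) : Prop := Disjoint A B ∨ A.card ≤ 1 ∨ B.card ≤ 1 ∨ (A = B ∧ A.card = 2)

lemma cpl3' {O A B C : Finset ℕ} (hA : A ⊆ O) (hB : B ⊆ O) (h : cpl A B) (hC : C.card ≤ 1) :
    A.card + B.card + C.card ≤ max (O.card + 2) 5 := by
  have a := card_le_card hA
  have b := card_le_card hB
  rcases h with h | h | h | ⟨rfl, h⟩
  · have := card_le_card (union_subset hA hB)
    rw [card_union_of_disjoint h] at this
    omega
  · omega
  · omega
  · omega

lemma cpl3 {O A B C : Finset ℕ} (hA : A ⊆ O) (hB : B ⊆ O) (hC : C ⊆ O) (hab : cpl A B)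
    (hac : cpl A C) (hbc : cpl B C) :
    A.card + B.card + C.card ≤ max (O.card + 2) 6 := by
  by_cases c1 : C.card ≤ 1
  · have := cpl3' hA hB hab c1; omega
  by_cases b1 : B.card ≤ 1
  · have := cpl3' hA hC hac b1; omega
  by_cases a1 : A.card ≤ 1
  · have := cpl3' hB hC hbc a1; omega
  have ab := card_le_card (union_subset hA hB)
  have ac := card_le_card (union_subset hA hC)
  have bc := card_le_card (union_subset hB hC)
  have abc := card_le_card (union_subset (union_subset hA hB) hC)
  unfold cpl at hab hac hbc
  simp only [c1, b1, a1, false_or] at hab hac hbc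
  rcases hab with hab | ⟨rfl, e⟩
  · rw [card_union_of_disjoint hab] at ab
    rcases hac with hac | ⟨rfl, e⟩
    · rcases hbc with hbc | ⟨rfl, e⟩
      · rw [card_union_of_disjoint (disjoint_union_left.2 ⟨hac, hbc⟩), card_union_of_disjoint hab] at abc
        omega
      · omega
    · omega
  · rcases hac with hac | ⟨rfl, e'⟩
    · rw [card_union_of_disjoint hac] at ac
      omega
    · omega

lemma dj33 {a b c x y z : ℕ} (h1 : a ≠ x) (h2 : a ≠ y) (h3 : a ≠ z) (h4 : b ≠ x) (h5 : b ≠ y)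
    (h6 : b ≠ z) (h7 : c ≠ x) (h8 : c ≠ y) (h9 : c ≠ z) :
    Disjoint ({a, b, c} : Finset ℕ) {x, y, z} := by
  simp [*, Ne.symm]

section
variable {V : Finset ℕ} {D1 D2 R : Finset (Finset ℕ)}

def Opq (R : Finset (Finset ℕ)) (O : Finset ℕ) (p q : ℕ) : Finset ℕ :=
  O.filter (fun o => {p, q, o} ∈ R)

lemma Dec.couple (h : Dec V D1 D2 R) {e1 e2 : Finset ℕ} (h1 : e1 ∈ D1) (h2 : e2 ∈ D2)
    {p p' q q' : ℕ} (hp : p ∈ e1) (hp' : p' ∈ e1) (hq : q ∈ e2) (hq' : q' ∈ e2) (hpp : p ≠ p')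
    (hqq : q ≠ q') :
    cpl (Opq R (V \ (e1 ∪ e2)) p q) (Opq R (V \ (e1 ∪ e2)) p' q') := by
  have hdj := h.dj e1 h1 e2 h2
  have ne : ∀ x ∈ e1, ∀ y ∈ e2, x ≠ y := fun x hx y hy hxy => disjoint_left.1 hdj hx (hxy ▸ hy)
  have hRf : P4Free R := h.free.mono subset_union_right
  set A := Opq R (V \ (e1 ∪ e2)) p q with hA
  set B := Opq R (V \ (e1 ∪ e2)) p' q' with hB
  by_cases hd : Disjoint A B
  · exact Or.inl hd
  by_cases ha : A.card ≤ 1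
  · exact Or.inr (Or.inl ha)
  by_cases hb : B.card ≤ 1
  · exact Or.inr (Or.inr (Or.inl hb))
  refine Or.inr (Or.inr (Or.inr ?_))
  obtain ⟨w, hwA, hwB⟩ := not_disjoint_iff.1 hd
  have nO : ∀ o, o ∈ A ∨ o ∈ B → ∀ x, x ∈ e1 ∨ x ∈ e2 → x ≠ o := by
    rintro o ho x hx rfl
    have : x ∉ e1 ∪ e2 := by
      rcases ho with ho | ho
      · exact (mem_sdiff.1 (mem_filter.1 ho).1).2
      · exact (mem_sdiff.1 (mem_filter.1 ho).1).2
    exact this (mem_union.2 hx)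
  have key : ∀ u ∈ A, ∀ v ∈ B, u ≠ w → v ≠ w → u = v := by
    intro u hu v hv huw hvw
    by_contra huv
    have n1 := nO u (Or.inl hu)
    have n2 := nO v (Or.inr hv)
    have n3 := nO w (Or.inl hwA)
    refine p4 hRf (mem_filter.1 hu).2 (mem_filter.1 hwA).2 (mem_filter.1 hwB).2 (mem_filter.1 hv).2
      ?_ ?_ ?_ ?_ ?_ ?_
    · exact not_disjoint_iff.2 ⟨p, by simp, by simp⟩
    · exact not_disjoint_iff.2 ⟨w, by simp, by simp⟩
    · exact not_disjoint_iff.2 ⟨p', by simp, by simp⟩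
    · exact dj33 hpp (ne p hp q' hq') (n3 p (Or.inl hp)) (ne p' hp' q hq).symm hqq (n3 q (Or.inr hq))
        (n1 p' (Or.inl hp')).symm (n1 q' (Or.inr hq')).symm huw
    · exact dj33 hpp (ne p hp q' hq') (n2 p (Or.inl hp)) (ne p' hp' q hq).symm hqq (n2 q (Or.inr hq))
        (n1 p' (Or.inl hp')).symm (n1 q' (Or.inr hq')).symm huv
    · exact dj33 hpp (ne p hp q' hq') (n2 p (Or.inl hp)) (ne p' hp' q hq).symm hqq (n2 q (Or.inr hq))
        (n3 p' (Or.inl hp')).symm (n3 q' (Or.inr hq')).symm hvw.symm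
  obtain ⟨u0, hu0, hu0w⟩ := exists_mem_ne (by omega : 1 < A.card) w
  obtain ⟨v0, hv0, hv0w⟩ := exists_mem_ne (by omega : 1 < B.card) w
  have huv := key u0 hu0 v0 hv0 hu0w hv0w
  subst huv
  have eA : A = {w, u0} := by
    ext x; rw [mem_insert, mem_singleton]
    refine ⟨fun hx => ?_, ?_⟩
    · by_cases hxw : x = w
      · exact Or.inl hxw
      · exact Or.inr (key x hx u0 hv0 hxw hv0w)
    · rintro (rfl | rfl) <;> assumption
  have eB : B = {w, u0} := by
    ext x; rw [mem_insert, mem_singleton]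
    refine ⟨fun hx => ?_, ?_⟩
    · by_cases hxw : x = w
      · exact Or.inl hxw
      · exact Or.inr (key u0 hu0 x hx hu0w hxw).symm
    · rintro (rfl | rfl) <;> assumption
  exact ⟨eA.trans eB.symm, by rw [eA]; exact card_pair hu0w.symm⟩

lemma Dec.out (h : Dec V D1 D2 R) {e1 e2 : Finset ℕ} (h1 : e1 ∈ D1) (h2 : e2 ∈ D2) :
    (R.filter (fun r => ¬ r ⊆ e1 ∪ e2)).card ≤
      ∑ x ∈ e1 ×ˢ e2, (Opq R (V \ (e1 ∪ e2)) x.1 x.2).card := by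
  have hdj := h.dj e1 h1 e2 h2
  have : R.filter (fun r => ¬ r ⊆ e1 ∪ e2) ⊆ (e1 ×ˢ e2).biUnion (fun x =>
      (Opq R (V \ (e1 ∪ e2)) x.1 x.2).image (fun o => {x.1, x.2, o})) := by
    intro r hr
    obtain ⟨hr, hrn⟩ := mem_filter.1 hr
    obtain ⟨o, hor, ho⟩ := not_subset.1 hrn
    obtain ⟨p, hpr, hp⟩ := h.meet1 hr h1
    obtain ⟨q, hqr, hq⟩ := h.swap.meet1 hr h2
    have e := trip_eq (h.tR r hr).2 hpr hqr hor (fun hh => disjoint_left.1 hdj hp (hh ▸ hq))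
      (fun hh => ho (mem_union_left _ (hh ▸ hp))) (fun hh => ho (mem_union_right _ (hh ▸ hq)))
    rw [mem_biUnion]
    refine ⟨(p, q), mem_product.2 ⟨hp, hq⟩, mem_image.2 ⟨o, ?_, e.symm⟩⟩
    exact mem_filter.2 ⟨mem_sdiff.2 ⟨(h.tR r hr).1 hor, ho⟩, e ▸ hr⟩
  refine (card_le_card this).trans (card_biUnion_le.trans ?_)
  exact sum_le_sum (fun x _ => card_image_le)

lemma Dec.cardO (h : Dec V D1 D2 R) {e1 e2 : Finset ℕ} (h1 : e1 ∈ D1) (h2 : e2 ∈ D2) :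
    (V \ (e1 ∪ e2)).card + 6 = V.card ∧ (e1 ∪ e2).card = 6 := by
  have hs : e1 ∪ e2 ⊆ V := union_subset (h.t1 e1 h1).1 (h.t2 e2 h2).1
  have hc : (e1 ∪ e2).card = 6 := by
    rw [card_union_of_disjoint (h.dj e1 h1 e2 h2), (h.t1 e1 h1).2, (h.t2 e2 h2).2]
  have := card_sdiff_add_card_eq_card hs
  omega

lemma Opq_sub {R : Finset (Finset ℕ)} {O : Finset ℕ} {p q : ℕ} : Opq R O p q ⊆ O := filter_subset _ _

/-- the pair case -/
lemma Dec.c22 (h : Dec V D1 D2 R) (hp : 2 ≤ (com D1).card) (hq : (com D2).card = 2)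
    (hm : 7 ≤ V.card) : Poor V.card (D1.card + D2.card + R.card) := by
  obtain ⟨e1, h1⟩ := h.ne1
  have b2 := h.c1two (by omega)
  obtain ⟨e2, h2, e2', h2', hne⟩ := one_lt_card.1 b2
  obtain ⟨q, q', hqq, hqe⟩ := card_eq_two.1 hq
  have hqc : q ∈ com D2 := by simp [hqe]
  have hqc' : q' ∈ com D2 := by simp [hqe]
  obtain ⟨w, hwq, hwq', rfl⟩ := pair_third h.t2 hqq h2 (com_sub h2 hqc) (com_sub h2 hqc')
  obtain ⟨w', hwq1, hwq1', rfl⟩ := pair_third h.t2 hqq h2' (com_sub h2' hqc) (com_sub h2' hqc')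
  have hww : w ≠ w' := by rintro rfl; exact hne rfl
  have hout := h.out h1 h2
  obtain ⟨hO, hU⟩ := h.cardO h1 h2
  have cpl := fun p hp p' hp' q hq q' hq' => h.couple h1 h2 (p := p) (p' := p') (q := q) (q' := q') hp hp' hq hq'
  have hw1 : ∀ p ∈ e1, (Opq R (V \ (e1 ∪ {q, q', w})) p w).card ≤ 1 := by
    intro p hp
    rw [card_le_one]
    have : ∀ o ∈ Opq R (V \ (e1 ∪ {q, q', w})) p w, o = w' := by
      intro o ho
      obtain ⟨ho, hoR⟩ := mem_filter.1 ho
      have hn : ∀ x ∈ ({q, q', w'} : Finset ℕ), p ≠ x := fun x hx hh =>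
        disjoint_left.1 (h.dj e1 h1 _ h2') hp (hh ▸ hx)
      obtain ⟨x, hx, hx'⟩ := h.swap.meet1 hoR h2'
      have hpx := hn x hx'
      simp only [mem_sdiff, mem_union, mem_insert, mem_singleton, not_or] at ho hx hx'
      rcases hx with rfl | rfl | rfl
      · exact absurd rfl hpx
      · rcases hx' with rfl | rfl | rfl
        · exact absurd rfl hwq
        · exact absurd rfl hwq'
        · exact absurd rfl hww
      · rcases hx' with rfl | rfl | rfl
        · exact absurd rfl ho.2.2.1
        · exact absurd rfl ho.2.2.2.1
        · rfl
    intro a ha b hb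
    rw [this a ha, this b hb]
  -- inside
  have hin : (R.filter (fun r => r ⊆ e1 ∪ {q, q', w})).card ≤ 15 := by
    set U := e1 ∪ {q, q', w} with hUd
    set F := R.filter (fun r => r ⊆ U) with hF
    have tF : ThreeGraphOn U F := fun r hr => ⟨(mem_filter.1 hr).2, (h.tR r (mem_filter.1 hr).1).2⟩
    have s := splitp (F := F) (w ∈ ·)
    have hwU : w ∈ U := by simp [hUd]
    have hdj := h.dj e1 h1 _ h2
    have hw'U : w' ∉ U := by
      simp only [hUd, mem_union, mem_insert, mem_singleton, not_or]
      exact ⟨fun hh => disjoint_left.1 (h.dj e1 h1 _ h2') hh (by simp), hwq1, hwq1', hww.symm⟩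
    have s1 : (F.filter (w ∈ ·)).card + 1 ≤ 7 := by
      have hn : ({q, q', w} : Finset ℕ) ∉ F.filter (w ∈ ·) := by
        intro hh
        exact h.h1 _ (mem_filter.1 (mem_filter.1 hh).1).1 e1 h1 hdj.symm
      rw [← card_insert_of_notMem hn]
      have := card_star_hit2 (V := U) (F := insert {q, q', w} (F.filter (w ∈ ·))) (p := w) (S := {q, q'}) (by
          intro r hr
          rcases mem_insert.1 hr with rfl | hr
          · exact ⟨subset_union_right, (h.t2 _ h2).2⟩
          · exact tF r (mem_filter.1 hr).1) hwU (by
          intro x; simp only [hUd, mem_union, mem_insert, mem_singleton]; tauto)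
          (by simp [hwq, hwq']) (card_pair hqq) (by
          intro r hr
          rcases mem_insert.1 hr with rfl | hr
          · simp
          · exact (mem_filter.1 hr).2) (by
          intro r hr
          rcases mem_insert.1 hr with rfl | hr
          · exact not_disjoint_iff.2 ⟨q, by simp, by simp⟩
          · have hr1 := (mem_filter.1 hr).1
            obtain ⟨x, hx, hx'⟩ := h.swap.meet1 (mem_filter.1 hr1).1 h2'
            refine not_disjoint_iff.2 ⟨x, hx, ?_⟩
            have hxU := (tF r hr1).1 hx
            simp only [mem_insert, mem_singleton] at hx' ⊢
            rcases hx' with rfl | rfl | rfl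
            · simp
            · simp
            · exact absurd hxU hw'U)
      omega
    have s2 : (F.filter (fun r => ¬ w ∈ r)).card + 1 ≤ 10 := by
      have hn : e1 ∉ F.filter (fun r => ¬ w ∈ r) := by
        intro hh
        exact h.h2 _ (mem_filter.1 (mem_filter.1 hh).1).1 _ h2 hdj
      rw [← card_insert_of_notMem hn]
      have := card_all (V := U.erase w) (F := insert e1 (F.filter (fun r => ¬ w ∈ r))) (by
        intro r hr
        rcases mem_insert.1 hr with rfl | hr
        · exact ⟨subset_erase.2 ⟨subset_union_left, fun hh => disjoint_left.1 hdj hh (by simp)⟩, (h.t1 _ h1).2⟩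
        · rw [mem_filter] at hr
          exact ⟨subset_erase.2 ⟨(tF r hr.1).1, hr.2⟩, (tF r hr.1).2⟩)
      rw [card_erase_of_mem hwU, hU, show Nat.choose (6 - 1) 3 = 10 by decide] at this
      exact this
    omega
  have s := splitp (F := R) (fun r => r ⊆ e1 ∪ {q, q', w})
  have d1 := card_of_com2 h.ne1 h.t1 hp
  have d2 := card_of_com2 h.ne2 h.t2 (by omega)
  have hab := h.ab
  obtain ⟨p1, p2, p3, n12, n13, n23, rfl⟩ := card_eq_three.1 (h.t1 e1 h1).2
  set O := V \ ({p1, p2, p3} ∪ {q, q', w}) with hOd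
  rw [sum_product] at hout
  simp only [sum_insert (show p1 ∉ ({p2, p3} : Finset ℕ) by simp [n12, n13]),
    sum_insert (show p2 ∉ ({p3} : Finset ℕ) by simp [n23]), sum_singleton,
    sum_insert (show q ∉ ({q', w} : Finset ℕ) by simp [hqq, hwq.symm]),
    sum_insert (show q' ∉ ({w} : Finset ℕ) by simp [hwq'.symm])] at hout
  have m1 : (p1 : ℕ) ∈ ({p1, p2, p3} : Finset ℕ) := by simp
  have m2 : (p2 : ℕ) ∈ ({p1, p2, p3} : Finset ℕ) := by simp
  have m3 : (p3 : ℕ) ∈ ({p1, p2, p3} : Finset ℕ) := by simp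
  have k1 : (q : ℕ) ∈ ({q, q', w} : Finset ℕ) := by simp
  have k2 : (q' : ℕ) ∈ ({q, q', w} : Finset ℕ) := by simp
  have t1 := cpl3' Opq_sub Opq_sub (cpl p1 m1 p2 m2 q k1 q' k2 n12 hqq) (hw1 p3 m3)
  have t2 := cpl3' Opq_sub Opq_sub (cpl p2 m2 p3 m3 q k1 q' k2 n23 hqq) (hw1 p1 m1)
  have t3 := cpl3' Opq_sub Opq_sub (cpl p3 m3 p1 m1 q k1 q' k2 n13.symm hqq) (hw1 p2 m2)
  have o (p q) : (Opq R O p q).card ≤ O.card := card_le_card Opq_sub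
  have o1 := o p1 q
  have o2 := o p1 q'
  have o3 := o p1 w
  have o4 := o p2 q
  have o5 := o p2 q'
  have o6 := o p2 w
  have o7 := o p3 q
  have o8 := o p3 q'
  have o9 := o p3 w
  unfold Poor
  omega

/-- complementary triples -/
lemma Dec.compl (h : Dec V D1 D2 R) {e1 e2 : Finset ℕ} (h1 : e1 ∈ D1) (h2 : e2 ∈ D2) {o : ℕ}
    (ho : o ∉ e1 ∪ e2)
    (hQ : 8 ≤ ((e1 ×ˢ e2).filter (fun x => {x.1, x.2, o} ∈ R)).card) {T T' : Finset ℕ}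
    (hT : T ∈ R) (hTU : T ⊆ e1 ∪ e2) (hT' : T' ∈ R) (hTT : T' = (e1 ∪ e2) \ T)
    (h2T : 2 ≤ (T ∩ e1).card) : False := by
  have hdj := h.dj e1 h1 e2 h2
  have hRf : P4Free R := h.free.mono subset_union_right
  have c3 : (e1 ×ˢ e2).card = 9 := by rw [card_product, (h.t1 e1 h1).2, (h.t2 e2 h2).2]
  have miss : ∀ x ∈ e1 ×ˢ e2, ∀ y ∈ e1 ×ˢ e2, x ≠ y → {x.1, x.2, o} ∈ R ∨ {y.1, y.2, o} ∈ R := by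
    intro x hx y hy hxy
    by_contra hcon
    push Not at hcon
    have : (e1 ×ˢ e2).filter (fun x => {x.1, x.2, o} ∈ R) ⊆ (e1 ×ˢ e2) \ {x, y} := by
      intro z hz
      rw [mem_filter] at hz
      rw [mem_sdiff, mem_insert, mem_singleton]
      refine ⟨hz.1, ?_⟩
      rintro (rfl | rfl)
      · exact hcon.1 hz.2
      · exact hcon.2 hz.2
    have := card_le_card this
    rw [card_sdiff_of_subset (by
      intro z; rw [mem_insert, mem_singleton]; rintro (rfl | rfl) <;> assumption), card_pair hxy] at this
    omega
  obtain ⟨q, hqT, hq⟩ := h.swap.meet1 hT h2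
  obtain ⟨p, hp, p', hp', hpp⟩ := one_lt_card.1 h2T
  rw [mem_inter] at hp hp'
  obtain ⟨p3, hp3T, hp3⟩ := h.meet1 hT' h1
  have hq' : ∃ q2 ∈ T', ∃ q3 ∈ T', q2 ∈ e2 ∧ q3 ∈ e2 ∧ q2 ≠ q3 := by
    have e : T = {p, p', q} := trip_eq (h.tR T hT).2 hp.1 hp'.1 hqT hpp
      (fun hh => disjoint_left.1 hdj hp.2 (hh ▸ hq)) (fun hh => disjoint_left.1 hdj hp'.2 (hh ▸ hq))
    have : 1 < (e2.erase q).card := by rw [card_erase_of_mem hq, (h.t2 e2 h2).2]; omega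
    obtain ⟨q2, hq2, q3, hq3, hne⟩ := one_lt_card.1 this
    rw [mem_erase] at hq2 hq3
    have : ∀ x, x ≠ q ∧ x ∈ e2 → x ∈ T' := by
      intro x hx
      rw [hTT, e]
      simp only [mem_sdiff, mem_union, mem_insert, mem_singleton, not_or]
      exact ⟨Or.inr hx.2, fun hh => disjoint_left.1 hdj hp.2 (hh ▸ hx.2),
        fun hh => disjoint_left.1 hdj hp'.2 (hh ▸ hx.2), hx.1⟩
    exact ⟨q2, this q2 hq2, q3, this q3 hq3, hq2.2, hq3.2, hne⟩
  obtain ⟨q2, hq2T, q3, hq3T, hq2, hq3, hqq⟩ := hq'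
  have hTd : Disjoint T T' := by rw [hTT]; exact disjoint_sdiff
  have hoT : o ∉ T := fun hh => ho (hTU hh)
  have hoT' : o ∉ T' := fun hh => ho (by rw [hTT] at hh; exact (mem_sdiff.1 hh).1)
  have A : ∃ x ∈ T, {x, q, o} ∈ R := by
    rcases miss (p, q) (mem_product.2 ⟨hp.2, hq⟩) (p', q) (mem_product.2 ⟨hp'.2, hq⟩) (by simp [hpp]) with hh | hh
    · exact ⟨p, hp.1, hh⟩
    · exact ⟨p', hp'.1, hh⟩
  have B : ∃ x ∈ T', {p3, x, o} ∈ R := by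
    rcases miss (p3, q2) (mem_product.2 ⟨hp3, hq2⟩) (p3, q3) (mem_product.2 ⟨hp3, hq3⟩) (by simp [hqq]) with hh | hh
    · exact ⟨q2, hq2T, hh⟩
    · exact ⟨q3, hq3T, hh⟩
  obtain ⟨x, hxT, hx⟩ := A
  obtain ⟨y, hyT, hy⟩ := B
  have d1 : ∀ z ∈ T, z ∉ T' := fun z hz => disjoint_left.1 hTd hz
  have d2 : ∀ z ∈ T', z ∉ T := fun z hz => disjoint_right.1 hTd hz
  refine p4 hRf hT hx hy hT' ?_ ?_ ?_ ?_ hTd ?_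
  · exact not_disjoint_iff.2 ⟨x, hxT, by simp⟩
  · exact not_disjoint_iff.2 ⟨o, by simp, by simp⟩
  · exact not_disjoint_iff.2 ⟨p3, by simp, hp3T⟩
  · simp only [disjoint_insert_right, disjoint_singleton_right]
    exact ⟨d2 _ hp3T, d2 _ hyT, hoT⟩
  · simp only [disjoint_insert_left, disjoint_singleton_left]
    exact ⟨d1 _ hxT, d1 _ hqT, hoT'⟩

lemma Dec.c33 (h : Dec V D1 D2 R) (hp : 3 ≤ (com D1).card) (hq : 3 ≤ (com D2).card)
    (hm : 7 ≤ V.card) : Poor V.card (D1.card + D2.card + R.card) := by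
  obtain ⟨e1, hD1, -, hc1⟩ := com_single h.ne1 h.t1 hp
  obtain ⟨e2, hD2, -, hc2⟩ := com_single h.ne2 h.t2 hq
  have h1 : e1 ∈ D1 := by simp [hD1]
  have h2 : e2 ∈ D2 := by simp [hD2]
  have c1 : D1.card = 1 := by simp [hD1]
  have c2 : D2.card = 1 := by simp [hD2]
  have hdj := h.dj e1 h1 e2 h2
  have hout := h.out h1 h2
  obtain ⟨hO, hU⟩ := h.cardO h1 h2
  have cpl := fun p hp p' hp' q hq q' hq' => h.couple h1 h2 (p := p) (p' := p') (q := q) (q' := q') hp hp' hq hq'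
  have s := splitp (F := R) (fun r => r ⊆ e1 ∪ e2)
  set F := R.filter (fun r => r ⊆ e1 ∪ e2) with hF
  have tF : ThreeGraphOn (e1 ∪ e2) F :=
    fun r hr => ⟨(mem_filter.1 hr).2, (h.tR r (mem_filter.1 hr).1).2⟩
  have hn1 : e1 ∉ F := fun hh => h.h2 _ (mem_filter.1 hh).1 _ h2 hdj
  have hn2 : e2 ∉ F := fun hh => h.h1 _ (mem_filter.1 hh).1 _ h1 hdj.symm
  have hne : e1 ≠ e2 := by
    rintro rfl
    exact (three_ne hc1).ne_empty (disjoint_self.1 hdj)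
  have bnd : ∀ K, ThreeGraphOn (e1 ∪ e2) K → e1 ∉ K → e2 ∉ K → K.card ≤ 18 := by
    intro K tK k1 k2
    have : (insert e1 (insert e2 K)).card ≤ _ := card_all (V := e1 ∪ e2) (by
      intro r hr
      rcases mem_insert.1 hr with rfl | hr
      · exact ⟨subset_union_left, hc1⟩
      rcases mem_insert.1 hr with rfl | hr
      · exact ⟨subset_union_right, hc2⟩
      · exact tK r hr)
    rw [card_insert_of_notMem (by simp [hne, k1]), card_insert_of_notMem k2, hU] at this
    have e : Nat.choose 6 3 = 20 := by decide
    omega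
  have hF18 := bnd F tF hn1 hn2
  by_cases h9 : 9 ≤ V.card
  · obtain ⟨p1, p2, p3, n12, n13, n23, rfl⟩ := card_eq_three.1 hc1
    obtain ⟨q1, q2, q3, k12, k13, k23, rfl⟩ := card_eq_three.1 hc2
    set O := V \ ({p1, p2, p3} ∪ {q1, q2, q3}) with hOd
    rw [sum_product] at hout
    simp only [sum_insert (show p1 ∉ ({p2, p3} : Finset ℕ) by simp [n12, n13]),
      sum_insert (show p2 ∉ ({p3} : Finset ℕ) by simp [n23]), sum_singleton,
      sum_insert (show q1 ∉ ({q2, q3} : Finset ℕ) by simp [k12, k13]),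
      sum_insert (show q2 ∉ ({q3} : Finset ℕ) by simp [k23])] at hout
    have m1 : (p1 : ℕ) ∈ ({p1, p2, p3} : Finset ℕ) := by simp
    have m2 : (p2 : ℕ) ∈ ({p1, p2, p3} : Finset ℕ) := by simp
    have m3 : (p3 : ℕ) ∈ ({p1, p2, p3} : Finset ℕ) := by simp
    have l1 : (q1 : ℕ) ∈ ({q1, q2, q3} : Finset ℕ) := by simp
    have l2 : (q2 : ℕ) ∈ ({q1, q2, q3} : Finset ℕ) := by simp
    have l3 : (q3 : ℕ) ∈ ({q1, q2, q3} : Finset ℕ) := by simp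
    have t1 := cpl3 Opq_sub Opq_sub Opq_sub (cpl p1 m1 p2 m2 q1 l1 q2 l2 n12 k12)
      (cpl p1 m1 p3 m3 q1 l1 q3 l3 n13 k13) (cpl p2 m2 p3 m3 q2 l2 q3 l3 n23 k23)
    have t2 := cpl3 Opq_sub Opq_sub Opq_sub (cpl p2 m2 p3 m3 q1 l1 q2 l2 n23 k12)
      (cpl p2 m2 p1 m1 q1 l1 q3 l3 n12.symm k13) (cpl p3 m3 p1 m1 q2 l2 q3 l3 n13.symm k23)
    have t3 := cpl3 Opq_sub Opq_sub Opq_sub (cpl p3 m3 p1 m1 q1 l1 q2 l2 n13.symm k12)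
      (cpl p3 m3 p2 m2 q1 l1 q3 l3 n23.symm k13) (cpl p1 m1 p2 m2 q2 l2 q3 l3 n12 k23)
    unfold Poor
    omega
  · set O := V \ (e1 ∪ e2) with hOd
    have hsw : ∑ x ∈ e1 ×ˢ e2, (Opq R O x.1 x.2).card =
        ∑ o ∈ O, ((e1 ×ˢ e2).filter (fun x => {x.1, x.2, o} ∈ R)).card := by
      simp only [card_filter, Opq]
      exact sum_comm
    rw [hsw] at hout
    have c9 : (e1 ×ˢ e2).card = 9 := by rw [card_product, hc1, hc2]
    by_cases h8 : ∃ o ∈ O, 8 ≤ ((e1 ×ˢ e2).filter (fun x => {x.1, x.2, o} ∈ R)).card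
    · obtain ⟨o, ho, h8⟩ := h8
      have hoU := (mem_sdiff.1 ho).2
      have b1 : ∑ o ∈ O, ((e1 ×ˢ e2).filter (fun x => {x.1, x.2, o} ∈ R)).card ≤ O.card • 9 := by
        apply sum_le_card_nsmul
        intro o _
        rw [← c9]; exact card_le_card (filter_subset _ _)
      rw [smul_eq_mul] at b1
      have hcomp : ∀ T ∈ F, (e1 ∪ e2) \ T ∉ F := by
        intro T hT hT'
        have hT1 := (mem_filter.1 hT).1
        have hTU := (mem_filter.1 hT).2
        have hT1' := (mem_filter.1 hT').1
        by_cases h2T : 2 ≤ (T ∩ e1).card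
        · exact h.compl h1 h2 hoU h8 hT1 hTU hT1' rfl h2T
        · refine h.compl h1 h2 hoU h8 hT1' sdiff_subset hT1 ?_ ?_
          · rw [Finset.sdiff_sdiff_eq_self hTU]
          · have e : ((e1 ∪ e2) \ T) ∩ e1 = e1 \ T := by
              ext x; simp only [mem_inter, mem_sdiff, mem_union]; tauto
            rw [e]
            have := card_sdiff_add_card_inter e1 T
            rw [inter_comm e1 T] at this
            omega
      have hinj : (F.image (fun T => (e1 ∪ e2) \ T)).card = F.card := by
        apply card_image_of_injOn
        intro T hT T' hT' hh
        simp only at hh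
        rw [← Finset.sdiff_sdiff_eq_self (mem_filter.1 hT).2, hh, Finset.sdiff_sdiff_eq_self (mem_filter.1 hT').2]
      have hdF : Disjoint F (F.image (fun T => (e1 ∪ e2) \ T)) := by
        rw [disjoint_right]
        intro T hT
        obtain ⟨T', hT', rfl⟩ := mem_image.1 hT
        exact hcomp T' hT'
      have hcp : ∀ T ∈ F, (e1 ∪ e2) \ T ≠ e1 ∧ (e1 ∪ e2) \ T ≠ e2 := by
        intro T hT
        have hTU := (mem_filter.1 hT).2
        refine ⟨fun hh => hn2 ?_, fun hh => hn1 ?_⟩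
        · have : T = e2 := by
            rw [← Finset.sdiff_sdiff_eq_self hTU, hh]
            exact union_sdiff_cancel_left hdj
          exact this ▸ hT
        · have : T = e1 := by
            rw [← Finset.sdiff_sdiff_eq_self hTU, hh]
            exact union_sdiff_cancel_right hdj
          exact this ▸ hT
      have := bnd (F ∪ F.image (fun T => (e1 ∪ e2) \ T)) (by
        intro r hr
        rcases mem_union.1 hr with hr | hr
        · exact tF r hr
        · obtain ⟨T, hT, rfl⟩ := mem_image.1 hr
          refine ⟨sdiff_subset, ?_⟩
          rw [card_sdiff_of_subset (mem_filter.1 hT).2, (tF T hT).2, hU]) (by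
        rw [mem_union, mem_image]
        rintro (hh | ⟨T, hT, hh⟩)
        · exact hn1 hh
        · exact (hcp T hT).1 hh) (by
        rw [mem_union, mem_image]
        rintro (hh | ⟨T, hT, hh⟩)
        · exact hn2 hh
        · exact (hcp T hT).2 hh)
      rw [card_union_of_disjoint hdF, hinj] at this
      unfold Poor
      omega
    · push Not at h8
      have b1 : ∑ o ∈ O, ((e1 ×ˢ e2).filter (fun x => {x.1, x.2, o} ∈ R)).card ≤ O.card • 7 := by
        apply sum_le_card_nsmul
        intro o ho
        have := h8 o ho
        omega
      rw [smul_eq_mul] at b1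
      unfold Poor
      omega
end

inductive Str (V : Finset ℕ) (H : Finset (Finset ℕ)) : Prop
  | s0 (x : ℕ) (h : ∀ e ∈ H, x ∈ e) : Str V H
  | s1 (h : Poor V.card H.card) : Str V H
  | s2 (D1 D2 : Finset (Finset ℕ)) (h : Dec V D1 D2 ∅) (e : H = D1 ∪ D2 ∪ ∅) : Str V H
  | s3 (D1 D2 R : Finset (Finset ℕ)) (h : Dec V D1 D2 R) (e : H = D1 ∪ D2 ∪ R)
      (hR : R.card ≤ 9) (hc : (com D1).Nonempty) : Str V H
  | s4 (D1 D2 R : Finset (Finset ℕ)) (x : ℕ) (h : Dec V D1 D2 R) (e : H = D1 ∪ D2 ∪ R)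
      (hx : com D2 = {x}) (hR : ∀ r ∈ R, x ∈ r) (hc : (com D1).Nonempty) : Str V H

lemma not_com {D : Finset (Finset ℕ)} (hD : D.Nonempty) (h : ¬ (com D).Nonempty) :
    ∀ v, ∃ d ∈ D, v ∉ d := by
  intro v
  by_contra hc
  push Not at hc
  exact h ⟨v, (mem_com hD).2 hc⟩

lemma structural {V : Finset ℕ} {H : Finset (Finset ℕ)} (hH : ThreeGraphOn V H) (hf : P4Free H)
    (hm : 7 ≤ V.card) : Str V H := by
  by_cases h0 : ∃ x, ∀ e ∈ H, x ∈ e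
  · obtain ⟨x, hx⟩ := h0
    exact Str.s0 x hx
  push Not at h0
  by_cases hi : ∃ e ∈ H, ∃ f ∈ H, Disjoint e f
  swap
  · push Not at hi
    apply Str.s1
    have := inter_bound hH hi h0
    unfold Poor
    omega
  obtain ⟨D1, D2, R, h, e⟩ := exists_dec hH hf hi
  have hcard : H.card = D1.card + D2.card + R.card := by rw [e, h.card]
  have hcard' : H.card = D2.card + D1.card + R.card := by omega
  have e' : H = D2 ∪ D1 ∪ R := by rw [e, union_comm D1 D2]
  rcases R.eq_empty_or_nonempty with rfl | ⟨r, hr⟩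
  · exact Str.s2 D1 D2 h e
  by_cases n2 : (com D2).Nonempty
  swap
  · have hns := not_com h.ne2 n2
    have n1 : (com D1).Nonempty := by
      obtain ⟨p, hp, -⟩ := h.gam hr (fun v _ _ => hns v)
      exact ⟨p, hp⟩
    by_cases h9 : R.card ≤ 9
    · exact Str.s3 D1 D2 R h e h9 n1
    · apply Str.s1
      rw [hcard]
      exact h.case1 hns hm (by omega)
  by_cases n1 : (com D1).Nonempty
  swap
  · have hns := not_com h.ne1 n1
    by_cases h9 : R.card ≤ 9
    · exact Str.s3 D2 D1 R h.swap e' h9 n2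
    · apply Str.s1
      rw [hcard']
      exact h.swap.case1 hns hm (by omega)
  have p1 := card_pos.2 n1
  have p2 := card_pos.2 n2
  have l1 := com_le h.ne1 h.t1
  have l2 := com_le h.ne2 h.t2
  by_cases c2 : (com D2).card = 1
  · obtain ⟨q, hq⟩ := card_eq_one.1 c2
    by_cases hRq : ∀ r ∈ R, q ∈ r
    · exact Str.s4 D1 D2 R q h e hq hRq n1
    push Not at hRq
    by_cases c1 : (com D1).card = 1
    · obtain ⟨p, hp⟩ := card_eq_one.1 c1
      by_cases hRp : ∀ r ∈ R, p ∈ r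
      · exact Str.s4 D2 D1 R p h.swap e' hp hRp n2
      push Not at hRp
      exact Str.s1 (hcard ▸ h.c11 hp hq hRq hRp)
    by_cases c1' : (com D1).card = 2
    · exact Str.s1 (hcard ▸ h.c21 c1' hq hRq)
    · exact Str.s1 (hcard ▸ h.c31 (by omega) hq hRq hm)
  by_cases c1 : (com D1).card = 1
  · obtain ⟨p, hp⟩ := card_eq_one.1 c1
    by_cases hRp : ∀ r ∈ R, p ∈ r
    · exact Str.s4 D2 D1 R p h.swap e' hp hRp n2
    push Not at hRp
    by_cases c2' : (com D2).card = 2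
    · exact Str.s1 (hcard' ▸ h.swap.c21 c2' hp hRp)
    · exact Str.s1 (hcard' ▸ h.swap.c31 (by omega) hp hRp hm)
  by_cases c2' : (com D2).card = 2
  · exact Str.s1 (hcard ▸ h.c22 (by omega) c2' hm)
  by_cases c1' : (com D1).card = 2
  · exact Str.s1 (hcard' ▸ h.swap.c22 (by omega) c1' hm)
  exact Str.s1 (hcard ▸ h.c33 (by omega) (by omega) hm)

def phi (m : ℕ) : ℕ :=
  if m ≤ 6 then m.choose 3 else if m = 7 then 27 else if m = 8 then 35 else if m = 9 then 40
  else if m = 10 then 43 else (m - 1).choose 2 + 1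

section
variable {V : Finset ℕ} {D1 D2 R : Finset (Finset ℕ)}

/-- Counting in situation S4. -/
lemma Dec.s4count (h : Dec V D1 D2 R) {x : ℕ} (hx : com D2 = {x}) (hR : ∀ r ∈ R, x ∈ r)
    (hc : (com D1).Nonempty) :
    4 ≤ (supp D2).card ∧ x ∈ supp D2 ∧
    (D1.card = 1 ∨
     (4 ≤ (supp D1).card ∧ D1.card + D2.card + R.card ≤
        ((supp D1).card - 1).choose 2 + ((supp D2).card - 1).choose 2 + V.card + 2) ∨
     (2 ≤ (com D1).card ∧ D1.card = 2 ∧ (supp D1).card = 4 ∧ D1.card + D2.card + R.card + 6 ≤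
        (supp D1).card + ((supp D2).card - 1).choose 2 + 2 * V.card) ∨
     (5 ≤ (supp D1).card ∧ D1.card + D2.card + R.card + 7 ≤
        (supp D1).card + ((supp D2).card - 1).choose 2 + 2 * V.card)) := by
  have hxs : x ∈ supp D2 := by
    have h2 : x ∈ com D2 := by simp [hx]
    exact (mem_filter.1 h2).1
  have hxd : ∀ d ∈ D2, x ∈ d := fun d hd => com_sub hd (by simp [hx])
  have b4 := supp_four h.t2 (h.c1two (by rw [hx]; simp))
  refine ⟨b4, hxs, ?_⟩
  have d2 := card_star h.t2.on_supp hxd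
  by_cases c3 : 3 ≤ (com D1).card
  · left
    obtain ⟨e, hD1, -⟩ := com_single h.ne1 h.t1 c3
    simp [hD1]
  right
  have a2 := h.swap.c1two (by omega)
  have a4 := supp_four h.t1 a2
  by_cases c2 : (com D1).card = 2
  · right
    obtain ⟨p, p', hpp, hpe⟩ := card_eq_two.1 c2
    have hRx : R.filter (x ∈ ·) = R := filter_true_of_mem hR
    have e3 := h.Rq_bound hpp (by simp [hpe]) (by simp [hpe]) hxs a2
    rw [hRx] at e3
    have e2 := card_of_com2 h.ne1 h.t1 (by omega)
    by_cases h3 : 3 ≤ D1.card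
    · have := e3.2 h3
      right
      omega
    · left
      have hD2 : D1.card = 2 := by omega
      refine ⟨by omega, hD2, ?_, by omega⟩
      obtain ⟨d, d', hne, hdd⟩ := card_eq_two.1 hD2
      have hs : supp D1 = d ∪ d' := by rw [hdd]; simp [supp]
      have hd : d ∈ D1 := by simp [hdd]
      have hd' : d' ∈ D1 := by simp [hdd]
      have hi : 2 ≤ (d ∩ d').card := by
        rw [← c2]; exact card_le_card (subset_inter (com_sub hd) (com_sub hd'))
      have := card_union_add_card_inter d d'
      rw [(h.t1 d hd).2, (h.t1 d' hd').2, ← hs] at this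
      omega
  · left
    have c1 : (com D1).card = 1 := by have := card_pos.2 hc; omega
    obtain ⟨p, hp⟩ := card_eq_one.1 c1
    obtain ⟨G', hG', hqG', hb', -, h4'⟩ := h.swap.c1gam hp
    rw [hx] at hb'
    simp only [card_singleton, one_mul] at hb'
    have d1 := card_star h.t1.on_supp (p := p) (fun d hd => com_sub hd (by simp [hp]))
    have s := splitp (F := R) (p ∈ ·)
    have hpx : p ≠ x := by
      rintro rfl
      have h1 : p ∈ com D1 := by simp [hp]
      exact disjoint_left.1 h.sdj (mem_filter.1 h1).1 hxs
    have s4 := card_pr (h.tR.filt (p ∈ ·)) hpx (by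
      intro f hf; rw [mem_filter] at hf; exact ⟨hf.2, hR f hf.1⟩)
    have := h.ab
    refine ⟨a4, ?_⟩
    omega

end

lemma cz (k : ℕ) (h : 1 ≤ k) : (2 : ℤ) * (((k - 1).choose 2 : ℕ) : ℤ) = ((k : ℤ) - 1) * ((k : ℤ) - 2) := by
  obtain ⟨j, rfl⟩ := Nat.exists_eq_add_of_le' h
  rw [Nat.add_sub_cancel]
  induction j with
  | zero => simp
  | succ i ih =>
    rw [c2]
    have := ih (by omega)
    push_cast at this ⊢
    linarith

lemma cz4 (k : ℕ) (h : 4 ≤ k) : (2 : ℤ) * (((k - 4).choose 2 : ℕ) : ℤ) = ((k : ℤ) - 4) * ((k : ℤ) - 5) := by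
  have := cz (k - 3) (by omega)
  rw [show k - 3 - 1 = k - 4 by omega] at this
  rw [this]
  push_cast [show 3 ≤ k by omega]
  ring

lemma phi_big {m : ℕ} (h : 11 ≤ m) : phi m = (m - 1).choose 2 + 1 := by
  unfold phi
  rw [if_neg (by omega), if_neg (by omega), if_neg (by omega), if_neg (by omega), if_neg (by omega)]

lemma phi_bigz {m : ℕ} (h : 11 ≤ m) : (2 : ℤ) * (phi m : ℤ) = ((m : ℤ) - 1) * ((m : ℤ) - 2) + 2 := by
  rw [phi_big h]; push_cast; have := cz m (by omega); linarith

lemma phi_tab : phi 3 = 1 ∧ phi 4 = 4 ∧ phi 5 = 10 ∧ phi 6 = 20 ∧ phi 7 = 27 ∧ phi 8 = 35 ∧ phi 9 = 40 ∧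
    phi 10 = 43 := by decide

lemma phi_upz {m : ℕ} (h : 3 ≤ m) : (2 : ℤ) * (phi m : ℤ) ≤ ((m : ℤ) - 1) * ((m : ℤ) - 2) + 28 := by
  by_cases h' : 11 ≤ m
  · rw [phi_bigz h']; omega
  · obtain ⟨t3, t4, t5, t6, t7, t8, t9, t10⟩ := phi_tab
    have : m ≤ 10 := by omega
    interval_cases m <;> simp [*]

lemma phi_low {m : ℕ} (h : 7 ≤ m) : (m - 1).choose 2 + 1 ≤ phi m := by
  by_cases h' : 11 ≤ m
  · rw [phi_big h']
  · have : m ≤ 10 := by omega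
    interval_cases m <;> decide

lemma phi_46 {m : ℕ} (h : 11 ≤ m) : 46 ≤ phi m := by
  have := phi_bigz h
  zify at *
  nlinarith

lemma NA1 {m k : ℕ} (hm : 7 ≤ m) (h : Poor m k) : k ≤ phi m ∧ (11 ≤ m → k < phi m) := by
  by_cases h' : 11 ≤ m
  · have h1 := phi_bigz h'
    have h2 := phi_46 h'
    have : k < phi m := by
      rcases h with h | h | ⟨-, h | h | h⟩
      · omega
      · omega
      · omega
      · zify at *; nlinarith
      · zify at *; nlinarith
    exact ⟨this.le, fun _ => this⟩
  · refine ⟨?_, fun hh => absurd hh h'⟩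
    obtain ⟨t3, t4, t5, t6, t7, t8, t9, t10⟩ := phi_tab
    have : m ≤ 10 := by omega
    unfold Poor at h
    interval_cases m <;> omega

lemma NA2 {m a b : ℕ} (hm : 7 ≤ m) (ha : 3 ≤ a) (hb : 3 ≤ b) (hab : a + b ≤ m) :
    phi a + phi b ≤ phi m ∧ (11 ≤ m → phi a + phi b < phi m) := by
  by_cases h' : 11 ≤ m
  · have : phi a + phi b < phi m := by
      by_cases hp : 29 ≤ a * b
      · have h1 := phi_bigz h'
        have h2 := phi_upz ha
        have h3 := phi_upz hb
        zify at *
        nlinarith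
      · have h4 := phi_46 h'
        have : a ≤ 9 := by nlinarith
        have : b ≤ 9 := by nlinarith
        obtain ⟨t3, t4, t5, t6, t7, t8, t9, t10⟩ := phi_tab
        interval_cases a <;> interval_cases b <;> omega
    exact ⟨this.le, fun _ => this⟩
  · refine ⟨?_, fun hh => absurd hh h'⟩
    obtain ⟨t3, t4, t5, t6, t7, t8, t9, t10⟩ := phi_tab
    have : m ≤ 10 := by omega
    have : a ≤ 7 := by omega
    have : b ≤ 7 := by omega
    interval_cases m <;> interval_cases a <;> first | omega | (interval_cases b <;> omega)

lemma c2tab : Nat.choose 2 2 = 1 ∧ Nat.choose 3 2 = 3 ∧ Nat.choose 4 2 = 6 ∧ Nat.choose 5 2 = 10 ∧ Nat.choose 6 2 = 15 := by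
  decide

lemma NA3 {m a b : ℕ} (hm : 7 ≤ m) (ha : 3 ≤ a) (hb : 3 ≤ b) (hab : a + b ≤ m) :
    (a - 1).choose 2 + phi b + 9 ≤ phi m ∧ (11 ≤ m → (a - 1).choose 2 + phi b + 9 < phi m) := by
  obtain ⟨t3, t4, t5, t6, t7, t8, t9, t10⟩ := phi_tab
  obtain ⟨u2, u3, u4, u5, u6⟩ := c2tab
  by_cases h' : 11 ≤ m
  · have : (a - 1).choose 2 + phi b + 9 < phi m := by
      by_cases hp : 24 ≤ a * b
      · have h1 := phi_bigz h'
        have h2 := cz a (by omega)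
        have h3 := phi_upz hb
        zify at *
        nlinarith
      · have h4 := phi_46 h'
        have : a ≤ 7 := by nlinarith
        have : b ≤ 7 := by nlinarith
        interval_cases a <;> interval_cases b <;> simp only [Nat.reduceSub] <;> omega
    exact ⟨this.le, fun _ => this⟩
  · refine ⟨?_, fun hh => absurd hh h'⟩
    have : m ≤ 10 := by omega
    have : a ≤ 7 := by omega
    have : b ≤ 7 := by omega
    interval_cases a <;> interval_cases b <;> simp only [Nat.reduceSub] <;> interval_cases m <;> omega

lemma NA4 {m a b : ℕ} (ha : 4 ≤ a) (hb : 4 ≤ b) (hab : a + b ≤ m) :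
    (a - 1).choose 2 + (b - 1).choose 2 + m + 2 < (m - 1).choose 2 + 1 := by
  have h1 := cz a (by omega)
  have h2 := cz b (by omega)
  have h3 := cz m (by omega)
  zify at *
  nlinarith

lemma NA5 {m a b : ℕ} (ha : 4 ≤ a) (hb : 4 ≤ b) (hab : a + b ≤ m) :
    a + (b - 1).choose 2 + 2 * m < (m - 1).choose 2 + 1 + 6 := by
  have h2 := cz b (by omega)
  have h3 := cz m (by omega)
  obtain ⟨d, rfl⟩ := Nat.exists_eq_add_of_le (show b ≤ m by omega)
  have : a ≤ d := by omega
  zify at *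
  nlinarith [mul_nonneg (show (0 : ℤ) ≤ d - 4 by linarith) (show (0 : ℤ) ≤ b - 4 by linarith)]

lemma NT1 {m k : ℕ} (hm : 14 ≤ m) (h : Poor m k) : k < (m - 4).choose 2 + 11 := by
  have h1 := cz4 m (by omega)
  have : (56 : ℤ) ≤ ((m - 4).choose 2 : ℕ) + 11 := by zify at *; nlinarith
  rcases h with h | h | ⟨-, h | h | h⟩
  · omega
  · omega
  · zify at *; nlinarith
  · zify at *; nlinarith
  · zify at *; nlinarith

lemma monoz {m s : ℤ} (h : s ≤ m) (h5 : 5 ≤ s) : (s - 4) * (s - 5) ≤ (m - 4) * (m - 5) := by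
  nlinarith [mul_nonneg (show 0 ≤ m - s by linarith) (show 0 ≤ m + s - 9 by linarith)]

lemma NT2 {m a b : ℕ} (hm : 14 ≤ m) (ha : 3 ≤ a) (hb : 3 ≤ b) (hab : a + b ≤ m) (h : a ≤ b) :
    phi a + phi b < (m - 4).choose 2 + 11 := by
  have h1 := cz4 m (by omega)
  obtain ⟨t3, t4, t5, t6, t7, t8, t9, t10⟩ := phi_tab
  by_cases h11 : 11 ≤ b
  · have h2 := phi_bigz h11
    have mab : (a + b : ℤ) ≤ m := by exact_mod_cast hab
    have b11 : (11 : ℤ) ≤ b := by exact_mod_cast h11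
    have h6 := monoz mab (by have : (3 : ℤ) ≤ a := by exact_mod_cast ha
                             linarith)
    by_cases ha11 : 11 ≤ a
    · have h3 := phi_bigz ha11
      have a11 : (11 : ℤ) ≤ a := by exact_mod_cast ha11
      zify
      nlinarith [mul_nonneg (show (0 : ℤ) ≤ a - 11 by linarith) (show (0 : ℤ) ≤ b - 11 by linarith)]
    · have : a ≤ 10 := by omega
      zify
      clear hab h hm mab h11
      interval_cases a <;> simp only [t3, t4, t5, t6, t7, t8, t9, t10] <;>
        push_cast at h6 ⊢ <;> clear t3 t4 t5 t6 t7 t8 t9 t10 <;> linarith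
  · have : b ≤ 10 := by omega
    have : a ≤ 10 := by omega
    have key : ∀ k : ℤ, (phi a + phi b : ℤ) + 1 ≤ k → 2 * k ≤ ((m : ℤ) - 4) * (m - 5) + 22 →
      phi a + phi b < (m - 4).choose 2 + 11 := by
      intro k h2 h3
      zify; linarith
    have m14 : (14 : ℤ) ≤ m := by exact_mod_cast hm
    have mab : (a + b : ℤ) ≤ m := by exact_mod_cast hab
    have a3 : (3 : ℤ) ≤ a := by exact_mod_cast ha
    have b3 : (3 : ℤ) ≤ b := by exact_mod_cast hb
    have h6 := monoz mab (by linarith)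
    have h7 := monoz m14 (by norm_num)
    refine key _ le_rfl ?_
    clear key h1 hm hab h11 a3 b3 mab m14
    interval_cases b <;> simp only [t3, t4, t5, t6, t7, t8, t9, t10] <;>
      interval_cases a <;> simp only [t3, t4, t5, t6, t7, t8, t9, t10] <;>
        clear t3 t4 t5 t6 t7 t8 t9 t10 <;> push_cast at h6 ⊢ <;> linarith

lemma NT3 {m a b : ℕ} (hm : 14 ≤ m) (ha : 3 ≤ a) (hb : 3 ≤ b) (hab : a + b ≤ m) :
    (a - 1).choose 2 + phi b + 9 ≤ (m - 4).choose 2 + 11 ∧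
    ((a - 1).choose 2 + phi b + 9 = (m - 4).choose 2 + 11 → a = 3 ∧ b + 3 = m) := by
  have h1 := cz4 m (by omega)
  have h2 := cz a (by omega)
  obtain ⟨t3, t4, t5, t6, t7, t8, t9, t10⟩ := phi_tab
  by_cases h3 : a = 3 ∧ b + 3 = m
  · refine ⟨?_, fun _ => h3⟩
    obtain ⟨rfl, rfl⟩ := h3
    have := phi_bigz (show 11 ≤ b by omega)
    zify at *
    push_cast at *
    nlinarith
  · suffices (a - 1).choose 2 + phi b + 9 < (m - 4).choose 2 + 11 from ⟨this.le, fun h => by omega⟩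
    have m14 : (14 : ℤ) ≤ m := by exact_mod_cast hm
    have mab : (a + b : ℤ) ≤ m := by exact_mod_cast hab
    by_cases h11 : 11 ≤ b
    · have h4 := phi_bigz h11
      by_cases ha3 : a = 3
      · subst ha3
        have : b + 4 ≤ m := by omega
        zify at *
        nlinarith
      · have : 4 ≤ a := by omega
        zify at *
        nlinarith [mul_nonneg (show (0 : ℤ) ≤ a - 4 by linarith) (show (0 : ℤ) ≤ b - 11 by linarith)]
    · have : b ≤ 10 := by omega
      have ha3 : (3 : ℤ) ≤ a := by exact_mod_cast ha
      have b3 : (3 : ℤ) ≤ b := by exact_mod_cast hb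
      have h6 := monoz mab (by linarith)
      have h7 := monoz m14 (by norm_num)
      zify
      clear hab hm mab h3 m14
      by_cases a9 : 9 ≤ a
      · have a9z : (9 : ℤ) ≤ a := by exact_mod_cast a9
        clear ha a9
        interval_cases b <;> simp only [t3, t4, t5, t6, t7, t8, t9, t10] <;>
          push_cast at h6 ⊢ <;> clear t3 t4 t5 t6 t7 t8 t9 t10 <;> linarith
      · have a8 : a ≤ 8 := by omega
        interval_cases b <;> simp only [t3, t4, t5, t6, t7, t8, t9, t10] <;>
          clear t3 t4 t5 t6 t7 t8 t9 t10 <;>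
          interval_cases a <;> push_cast at h6 h2 ⊢ <;> linarith

lemma NT4 {m a b : ℕ} (hm : 14 ≤ m) (ha : 4 ≤ a) (hb : 4 ≤ b) (hab : a + b ≤ m) :
    (a - 1).choose 2 + (b - 1).choose 2 + m + 2 < (m - 4).choose 2 + 11 := by
  have h1 := cz a (by omega)
  have h2 := cz b (by omega)
  have h3 := cz4 m (by omega)
  zify at *
  nlinarith [mul_nonneg (show (0 : ℤ) ≤ a - 4 by linarith) (show (0 : ℤ) ≤ b - 4 by linarith)]

lemma NT5 {m a b : ℕ} (hm : 14 ≤ m) (ha : 5 ≤ a) (hb : 4 ≤ b) (hab : a + b ≤ m) :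
    a + (b - 1).choose 2 + 2 * m < (m - 4).choose 2 + 11 + 7 := by
  have h2 := cz b (by omega)
  have h3 := cz4 m (by omega)
  zify at *
  nlinarith [mul_nonneg (show (0 : ℤ) ≤ a - 5 by linarith) (show (0 : ℤ) ≤ b - 4 by linarith),
    mul_nonneg (show (0 : ℤ) ≤ m - a - b by linarith) (show (0 : ℤ) ≤ m + a + b - 13 by linarith)]

lemma card_starplus {V e : Finset ℕ} {x : ℕ} :
    ((V.powersetCard 3).filter (fun t => x ∈ t) ∪ {e}).card ≤ (V.card - 1).choose 2 + 1 := by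
  refine (card_union_le _ _).trans ?_
  have : ThreeGraphOn V ((V.powersetCard 3).filter (fun t => x ∈ t)) := by
    intro f hf
    rw [mem_filter, mem_powersetCard] at hf
    exact hf.1
  have := card_star this (p := x) (fun f hf => (mem_filter.1 hf).2)
  simpa using this

lemma Dec.s4star {V : Finset ℕ} {D1 D2 R : Finset (Finset ℕ)} (h : Dec V D1 D2 R) {x : ℕ}
    (hx : com D2 = {x}) (hR : ∀ r ∈ R, x ∈ r) (h1 : D1.card = 1) :
    x ∈ V ∧ ∃ e : Finset ℕ, e ⊆ V ∧ e.card = 3 ∧ x ∉ e ∧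
      D1 ∪ D2 ∪ R ⊆ (V.powersetCard 3).filter (fun t => x ∈ t) ∪ {e} := by
  obtain ⟨e, rfl⟩ := card_eq_one.1 h1
  have hxd : ∀ d ∈ D2, x ∈ d := fun d hd => com_sub hd (by simp [hx])
  obtain ⟨d, hd⟩ := h.ne2
  have he := h.t1 e (by simp)
  refine ⟨(h.t2 d hd).1 (hxd d hd), e, he.1, he.2, ?_, ?_⟩
  · intro hxe
    exact disjoint_left.1 (h.dj e (by simp) d hd) hxe (hxd d hd)
  · intro f hf
    simp only [mem_union, mem_filter, mem_powersetCard, mem_singleton] at hf ⊢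
    rcases hf with (hf | hf) | hf
    · exact Or.inr hf
    · exact Or.inl ⟨h.t2 f hf, hxd f hf⟩
    · exact Or.inl ⟨h.tR f hf, hR f hf⟩

lemma thmA_aux : ∀ (m : ℕ) (V : Finset ℕ) (H : Finset (Finset ℕ)), V.card = m → ThreeGraphOn V H →
    P4Free H → H.card ≤ phi m ∧ (11 ≤ m → H.card = phi m → IsStarPlusOn V H) := by
  intro m
  induction m using Nat.strong_induction_on with
  | _ m ih =>
  intro V H hV hH hf
  by_cases hm : m ≤ 6
  · refine ⟨?_, by omega⟩
    have := card_all hH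
    unfold phi
    rw [if_pos hm, ← hV]; exact this
  have hm7 : 7 ≤ m := by omega
  have lo := phi_low hm7
  have strict : H.card ≤ phi m ∧ (11 ≤ m → H.card < phi m) →
      H.card ≤ phi m ∧ (11 ≤ m → H.card = phi m → IsStarPlusOn V H) := by
    rintro ⟨h1, h2⟩
    exact ⟨h1, fun h3 h4 => absurd (h2 h3) (by omega)⟩
  have bnd : ∀ D1 D2 R, Dec V D1 D2 R → D2.card ≤ phi (supp D2).card := by
    intro D1 D2 R h
    have := h.ab
    have := h.a3
    exact (ih _ (by omega) (supp D2) D2 rfl h.t2.on_supp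
      (h.free.mono (fun f hf => by simp [hf]))).1
  cases structural hH hf (by omega) with
  | s0 x hx =>
    apply strict
    have := card_star hH hx
    rw [hV] at this
    exact ⟨by omega, fun _ => by omega⟩
  | s1 h => exact strict (NA1 hm7 (hV ▸ h))
  | s2 D1 D2 h e =>
    apply strict
    have hc := h.card
    rw [← e, card_empty] at hc
    have h1 := bnd _ _ _ h
    have h2 := bnd _ _ _ h.swap
    have := NA2 hm7 h.a3 h.swap.a3 (hV ▸ h.ab)
    exact ⟨by omega, fun h3 => by have := this.2 h3; omega⟩
  | s3 D1 D2 R h e hR hc =>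
    apply strict
    have hcd := h.card
    rw [← e] at hcd
    have h1 := bnd _ _ _ h
    obtain ⟨p, hp⟩ := hc
    have h2 := card_star h.t1.on_supp (p := p) (fun d hd => com_sub hd hp)
    have := NA3 hm7 h.a3 h.swap.a3 (hV ▸ h.ab)
    exact ⟨by omega, fun h3 => by have := this.2 h3; omega⟩
  | s4 D1 D2 R x h e hx hR hc =>
    have hcd := h.card
    rw [← e] at hcd
    obtain ⟨b4, -, h1 | ⟨a4, h1⟩ | ⟨-, -, a4, h1⟩ | ⟨a5, h1⟩⟩ := h.s4count hx hR hc
    · obtain ⟨hxV, f, hfV, hf3, hxf, hs⟩ := h.s4star hx hR h1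
      rw [← e] at hs
      have hle := card_le_card hs
      have hsp := card_starplus (V := V) (e := f) (x := x)
      rw [hV] at hsp
      refine ⟨by omega, fun h11 heq => ⟨x, hxV, f, hfV, hf3, hxf, ?_⟩⟩
      rw [phi_big h11] at heq
      exact eq_of_subset_of_card_le hs (by omega)
    · apply strict
      have := NA4 a4 b4 h.ab
      rw [hV] at this h1
      exact ⟨by omega, fun _ => by omega⟩
    · apply strict
      have := NA5 a4.ge b4 h.ab
      rw [hV] at this h1
      exact ⟨by omega, fun _ => by omega⟩
    · apply strict
      have := NA5 (show 4 ≤ (supp D1).card by omega) b4 h.ab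
      rw [hV] at this h1
      exact ⟨by omega, fun _ => by omega⟩

lemma thmA {V : Finset ℕ} {H : Finset (Finset ℕ)} (hH : ThreeGraphOn V H) (hf : P4Free H) :
    H.card ≤ phi V.card ∧ (11 ≤ V.card → H.card = phi V.card → IsStarPlusOn V H) :=
  thmA_aux _ V H rfl hH hf

lemma seven_set (x a b c d e f : ℕ) :
    ({x, a, b, c, d, e, f} : Finset ℕ) = insert x ({a, b, c} ∪ {d, e, f}) := by
  rw [insert_union, insert_union, singleton_union]

lemma set_aux {e g : Finset ℕ} {S R : Finset (Finset ℕ)} :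
    {e} ∪ (S ∪ {g}) ∪ R = S ∪ insert g (insert e R) := by
  ext t
  simp only [mem_union, mem_insert, mem_singleton]
  tauto

lemma sub_starplus_of_star {V : Finset ℕ} {H : Finset (Finset ℕ)} (hH : ThreeGraphOn V H)
    (hV : 4 ≤ V.card) {x : ℕ} (hx : ∀ e ∈ H, x ∈ e) : SubStarPlus V H := by
  have key : ∃ y ∈ V, ∀ e ∈ H, y ∈ e := by
    by_cases hn : H.Nonempty
    · obtain ⟨e, he⟩ := hn
      exact ⟨x, (hH e he).1 (hx e he), hx⟩
    · rw [not_nonempty_iff_eq_empty] at hn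
      obtain ⟨y, hy⟩ := card_pos.1 (show 0 < V.card by omega)
      exact ⟨y, hy, by simp [hn]⟩
  obtain ⟨y, hyV, hy⟩ := key
  obtain ⟨e, he, he3⟩ := exists_subset_card_eq (s := V.erase y) (n := 3)
    (by rw [card_erase_of_mem hyV]; omega)
  refine ⟨_, ⟨y, hyV, e, he.trans (erase_subset _ _), he3, fun h => by simpa using he h, rfl⟩, ?_⟩
  intro f hf
  simp only [mem_union, mem_filter, mem_powersetCard]
  exact Or.inl ⟨hH f hf, hy f hf⟩

lemma Dec.sub_cb {V : Finset ℕ} {D1 D2 R : Finset (Finset ℕ)} (h : Dec V D1 D2 R) {x : ℕ}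
    (hx : com D2 = {x}) (hxs : x ∈ supp D2) (hR : ∀ r ∈ R, x ∈ r) (hc : 2 ≤ (com D1).card)
    (h2 : D1.card = 2) : SubCB V (D1 ∪ D2 ∪ R) := by
  have hxd : ∀ d ∈ D2, x ∈ d := fun d hd => com_sub hd (by simp [hx])
  obtain ⟨p, hp, p', hp', hpp⟩ := one_lt_card.1 (show 1 < (com D1).card by omega)
  obtain ⟨d, d', hne, hdd⟩ := card_eq_two.1 h2
  have hd : d ∈ D1 := by simp [hdd]
  have hd' : d' ∈ D1 := by simp [hdd]
  obtain ⟨w, hw1, hw2, rfl⟩ := pair_third h.t1 hpp hd (com_sub hd hp) (com_sub hd hp')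
  obtain ⟨w', hw1', hw2', rfl⟩ := pair_third h.t1 hpp hd' (com_sub hd' hp) (com_sub hd' hp')
  have hww : w ≠ w' := by rintro rfl; exact hne rfl
  have nx : ∀ v ∈ supp D1, v ≠ x := by
    rintro v hv rfl
    exact disjoint_left.1 h.sdj hv hxs
  have sp : p ∈ supp D1 := sub_supp hd (by simp)
  have sp' : p' ∈ supp D1 := sub_supp hd (by simp)
  have sw : w ∈ supp D1 := sub_supp hd (by simp)
  have sw' : w' ∈ supp D1 := sub_supp hd' (by simp)
  have xp := nx p sp
  have xp' := nx p' sp'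
  have xw := nx w sw
  have xw' := nx w' sw'
  refine ⟨_, ⟨x, p, p', w, w', ?_, ?_, rfl⟩, ?_⟩
  · intro v
    simp only [mem_insert, mem_singleton]
    rintro (rfl | rfl | rfl | rfl | rfl)
    · exact h.t2.supp_sub hxs
    all_goals exact h.t1.supp_sub (by assumption)
  · rw [card_insert_of_notMem, card_insert_of_notMem, card_insert_of_notMem, card_pair hww]
    · simp [hw2.symm, hw2'.symm]
    · simp [hw1.symm, hw1'.symm, hpp]
    · simp [xp.symm, xp'.symm, xw.symm, xw'.symm]
  · intro f hf
    rw [mem_union, mem_union] at hf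
    have star : ThreeGraphOn V {f} → x ∈ f → w ∉ f → w' ∉ f →
        f ∈ ((V \ {w, w'}).powersetCard 3).filter (fun t => x ∈ t) := by
      intro t hxf hwf hwf'
      have := t f (by simp)
      simp only [mem_filter, mem_powersetCard]
      refine ⟨⟨?_, this.2⟩, hxf⟩
      intro v hv
      simp only [mem_sdiff, mem_insert, mem_singleton, not_or]
      exact ⟨this.1 hv, fun hh => hwf (hh ▸ hv), fun hh => hwf' (hh ▸ hv)⟩
    rw [mem_union]
    rcases hf with (hf | hf) | hf
    · rw [hdd] at hf
      simp only [mem_insert, mem_singleton] at hf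
      right
      rcases hf with rfl | rfl <;> simp
    · left
      refine star (h.t2.mono (by simpa using hf)) (hxd f hf) ?_ ?_
      · exact fun hh => disjoint_left.1 h.sdj sw (sub_supp hf hh)
      · exact fun hh => disjoint_left.1 h.sdj sw' (sub_supp hf hh)
    · have hxf := hR f hf
      have f3 := (h.tR f hf).2
      by_cases hwf : w ∈ f <;> by_cases hwf' : w' ∈ f
      · right
        have : f = {x, w, w'} := trip_eq f3 hxf hwf hwf' xw.symm xw'.symm hww
        simp [this]
      · right
        by_cases hpf : p ∈ f
        · have : f = {x, p, w} := trip_eq f3 hxf hpf hwf xp.symm xw.symm hw1.symm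
          simp [this]
        by_cases hpf' : p' ∈ f
        · have : f = {x, p', w} := trip_eq f3 hxf hpf' hwf xp'.symm xw.symm hw2.symm
          simp [this]
        exact absurd (h.third_mem hd' hf hpf hpf') hwf'
      · right
        by_cases hpf : p ∈ f
        · have : f = {x, p, w'} := trip_eq f3 hxf hpf hwf' xp.symm xw'.symm hw1'.symm
          simp [this]
        by_cases hpf' : p' ∈ f
        · have : f = {x, p', w'} := trip_eq f3 hxf hpf' hwf' xp'.symm xw'.symm hw2'.symm
          simp [this]
        exact absurd (h.third_mem hd hf hpf hpf') hwf
      · left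
        exact star (h.tR.mono (by simpa using hf)) hxf hwf hwf'

lemma Dec.balloon {V : Finset ℕ} {D1 D2 R : Finset (Finset ℕ)} (h : Dec V D1 D2 R)
    (hb : 11 ≤ (supp D2).card) (h1 : D1.card = 1) (hR : R.card = 9)
    (hs : (supp D2).card + 3 = V.card) (hst : IsStarPlusOn (supp D2) D2) :
    IsBOn V (D1 ∪ D2 ∪ R) := by
  obtain ⟨e, rfl⟩ := card_eq_one.1 h1
  obtain ⟨x, hxs, g, hgs, g3, hxg, hD2⟩ := hst
  have he := h.t1 e (by simp)
  have hse : supp {e} = e := by simp [supp]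
  have hdj : Disjoint e (supp D2) := by have := h.sdj; rwa [hse] at this
  have hsV : supp D2 = V \ e := by
    apply eq_of_subset_of_card_le
    · intro v hv
      rw [mem_sdiff]
      exact ⟨h.t2.supp_sub hv, fun hh => disjoint_left.1 hdj hh hv⟩
    · rw [card_sdiff_of_subset he.1]; omega
  have hxR : ∀ r ∈ R, x ∈ r := by
    intro r hr
    by_contra hxr
    have hc : 1 < (supp D2 \ insert x r).card := by
      have := le_card_sdiff (insert x r) (supp D2)
      have := card_insert_le x r
      have := (h.tR r hr).2
      omega
    obtain ⟨u, hu, v, hv, huv⟩ := one_lt_card.1 hc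
    simp only [mem_sdiff, mem_insert, not_or] at hu hv
    have : ({x, u, v} : Finset ℕ) ∈ D2 := by
      rw [hD2]
      simp only [mem_union, mem_filter, mem_powersetCard]
      left
      refine ⟨⟨?_, ?_⟩, by simp⟩
      · intro y
        simp only [mem_insert, mem_singleton]
        rintro (rfl | rfl | rfl)
        exacts [hxs, hu.1, hv.1]
      · exact card_eq_three.2 ⟨x, u, v, fun hh => hu.2.1 hh.symm, fun hh => hv.2.1 hh.symm, huv, rfl⟩
    obtain ⟨y, hy, hyd⟩ := h.swap.meet1 hr this
    simp only [mem_insert, mem_singleton] at hyd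
    rcases hyd with rfl | rfl | rfl
    exacts [hxr hy, hu.2.2 hy, hv.2.2 hy]
  have hgD : g ∈ D2 := by rw [hD2]; simp
  have hRsub : ∀ r ∈ R, ∃ y ∈ g, ∃ z ∈ e, r = {x, y, z} := by
    intro r hr
    obtain ⟨y, hyr, hyg⟩ := h.swap.meet1 hr hgD
    obtain ⟨z, hzr, hze⟩ := h.meet1 hr (show e ∈ {e} by simp)
    refine ⟨y, hyg, z, hze, trip_eq (h.tR r hr).2 (hxR r hr) hyr hzr ?_ ?_ ?_⟩
    · rintro rfl; exact hxg hyg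
    · rintro rfl; exact disjoint_left.1 hdj hze hxs
    · rintro rfl; exact disjoint_left.1 hdj hze (hgs hyg)
  obtain ⟨y₁, y₂, y₃, y12, y13, y23, hgy⟩ := card_eq_three.1 g3
  obtain ⟨z₁, z₂, z₃, z12, z13, z23, hez⟩ := card_eq_three.1 he.2
  have hRe : R = ({{x, y₁, z₁}, {x, y₁, z₂}, {x, y₁, z₃},
        {x, y₂, z₁}, {x, y₂, z₂}, {x, y₂, z₃},
        {x, y₃, z₁}, {x, y₃, z₂}, {x, y₃, z₃}} : Finset (Finset ℕ)) := by
    apply eq_of_subset_of_card_le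
    · intro r hr
      obtain ⟨y, hy, z, hz, rfl⟩ := hRsub r hr
      rw [hgy] at hy
      rw [hez] at hz
      simp only [mem_insert, mem_singleton] at hy hz
      rcases hy with rfl | rfl | rfl <;> rcases hz with rfl | rfl | rfl <;> simp
    · rw [hR]
      refine (card_insert_le _ _).trans (Nat.succ_le_succ ?_)
      refine (card_insert_le _ _).trans (Nat.succ_le_succ ?_)
      refine (card_insert_le _ _).trans (Nat.succ_le_succ ?_)
      exact card_le_six
  have hxV := h.t2.supp_sub hxs
  have gV := hgs.trans h.t2.supp_sub
  have hxe : x ∉ e := fun hh => disjoint_left.1 hdj hh hxs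
  have hge : ∀ v ∈ g, v ∉ e := fun v hv hh => disjoint_left.1 hdj hh (hgs hv)
  have hset : ({x, y₁, y₂, y₃, z₁, z₂, z₃} : Finset ℕ) = insert x (g ∪ e) := by
    rw [hgy, hez]; exact seven_set _ _ _ _ _ _ _
  refine ⟨x, y₁, y₂, y₃, z₁, z₂, z₃, ?_, ?_, ?_⟩
  · rw [hset]
    intro v hv
    rw [mem_insert, mem_union] at hv
    rcases hv with rfl | hv | hv
    exacts [hxV, gV hv, he.1 hv]
  · rw [hset, card_insert_of_notMem (by simp [hxg, hxe]),
      card_union_of_disjoint (disjoint_left.2 hge), g3, he.2]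
  · rw [← hez, ← hsV]
    conv_lhs => rw [hD2]
    rw [hRe, ← hgy]
    exact set_aux

lemma card_full_star {W : Finset ℕ} {x : ℕ} (hx : x ∈ W) :
    ((W.powersetCard 3).filter (fun t => x ∈ t)).card = (W.card - 1).choose 2 := by
  have h1 := card_filter_add_card_filter_not (s := W.powersetCard 3) (x ∈ ·)
  have h2 : (W.powersetCard 3).filter (fun t => ¬ x ∈ t) = (W.erase x).powersetCard 3 := by
    ext t
    simp only [mem_filter, mem_powersetCard, subset_erase]
    tauto
  rw [h2, card_powersetCard, card_powersetCard, card_erase_of_mem hx] at h1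
  obtain ⟨k, hk⟩ := Nat.exists_eq_add_of_lt (card_pos.2 ⟨x, hx⟩)
  rw [hk] at h1 ⊢
  simp only [zero_add, Nat.add_sub_cancel] at h1 ⊢
  rw [Nat.choose_succ_succ' k 2] at h1
  simp only [Nat.reduceAdd] at h1
  omega

lemma balloon_card {V : Finset ℕ} {H : Finset (Finset ℕ)} (h : IsBOn V H) :
    (V.card - 4).choose 2 + 11 ≤ H.card := by
  obtain ⟨x, y₁, y₂, y₃, z₁, z₂, z₃, hsub, hc, rfl⟩ := h
  set Y : Finset ℕ := {y₁, y₂, y₃} with hY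
  set Z : Finset ℕ := {z₁, z₂, z₃} with hZ
  have hset : ({x, y₁, y₂, y₃, z₁, z₂, z₃} : Finset ℕ) = insert x (Y ∪ Z) := by
    exact seven_set _ _ _ _ _ _ _
  rw [hset] at hsub hc
  have cY : Y.card ≤ 3 := card_le_three
  have cZ : Z.card ≤ 3 := card_le_three
  have c1 := card_insert_le x (Y ∪ Z)
  have c2 := card_union_add_card_inter Y Z
  have Y3 : Y.card = 3 := by omega
  have Z3 : Z.card = 3 := by omega
  have hYZ : Disjoint Y Z := by
    rw [disjoint_iff_inter_eq_empty, ← card_eq_zero]; omega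
  have hx : x ∉ Y ∪ Z := by
    intro hh
    rw [insert_eq_of_mem hh] at hc
    omega
  rw [mem_union, not_or] at hx
  have hZV : Z ⊆ V := fun v hv => hsub (by simp [hv])
  have hxV : x ∈ V \ Z := mem_sdiff.2 ⟨hsub (by simp), hx.2⟩
  have hst := card_full_star hxV
  rw [card_sdiff_of_subset hZV, Z3, Nat.sub_sub] at hst
  set S := ((V \ Z).powersetCard 3).filter (fun t => x ∈ t) with hS
  set I := (Y ×ˢ Z).image (fun q => ({x, q.1, q.2} : Finset ℕ)) with hI
  have hIc : I.card = 9 := by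
    rw [hI, card_image_of_injOn, card_product, Y3, Z3]
    rintro ⟨y, z⟩ hq ⟨y', z'⟩ hq' he
    simp only [coe_product, Set.mem_prod, mem_coe] at hq hq'
    simp only at he
    have e1 : y ∈ ({x, y', z'} : Finset ℕ) := by rw [← he]; simp
    have e2 : z ∈ ({x, y', z'} : Finset ℕ) := by rw [← he]; simp
    simp only [mem_insert, mem_singleton] at e1 e2
    have f1 : y = y' := by
      rcases e1 with rfl | e | rfl
      exacts [absurd hq.1 hx.1, e, absurd hq'.2 (disjoint_left.1 hYZ hq.1)]
    have f2 : z = z' := by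
      rcases e2 with rfl | rfl | e
      exacts [absurd hq.2 hx.2, absurd hq.2 (disjoint_left.1 hYZ hq'.1), e]
    rw [f1, f2]
  have hSI : Disjoint S I := by
    rw [disjoint_left]
    intro t ht ht'
    rw [hS, mem_filter, mem_powersetCard] at ht
    rw [hI, mem_image] at ht'
    obtain ⟨⟨y, z⟩, hq, rfl⟩ := ht'
    have := ht.1.1 (show z ∈ _ by simp)
    exact (mem_sdiff.1 this).2 (mem_product.1 hq).2
  have hxSI : ∀ t ∈ S ∪ I, x ∈ t := by
    intro t ht
    rw [mem_union, hS, hI, mem_filter, mem_image] at ht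
    rcases ht with ht | ⟨q, -, rfl⟩
    · exact ht.2
    · simp
  have hYn : Y ∉ S ∪ I := fun hh => hx.1 (hxSI _ hh)
  have hZn : Z ∉ insert Y (S ∪ I) := by
    rw [mem_insert, not_or]
    refine ⟨?_, fun hh => hx.2 (hxSI _ hh)⟩
    intro hh
    rw [hh, disjoint_self_iff_empty] at hYZ
    rw [hYZ] at Y3
    simp at Y3
  have htot : (insert Z (insert Y (S ∪ I))).card = (V.card - 4).choose 2 + 11 := by
    rw [card_insert_of_notMem hZn, card_insert_of_notMem hYn, card_union_of_disjoint hSI, hst, hIc]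
  rw [← htot]
  apply card_le_card
  intro t ht
  rw [mem_insert, mem_insert, mem_union] at ht
  rw [mem_union]
  rcases ht with rfl | rfl | ht | ht
  · right; simp
  · right; simp
  · left; exact ht
  · right
    rw [hI, mem_image] at ht
    obtain ⟨⟨y, z⟩, hq, rfl⟩ := ht
    rw [mem_product] at hq
    simp only [hY, hZ, mem_insert, mem_singleton] at hq
    obtain ⟨rfl | rfl | rfl, rfl | rfl | rfl⟩ := hq <;> simp

lemma main_bound {V : Finset ℕ} {H : Finset (Finset ℕ)} (hV : 14 ≤ V.card) (hH : ThreeGraphOn V H)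
    (hfree : P4Free H) (hns : ¬SubStarPlus V H) (hncb : ¬SubCB V H) :
    H.card ≤ (V.card - 4).choose 2 + 11 ∧ (H.card = (V.card - 4).choose 2 + 11 → IsBOn V H) := by
  have strict : H.card < (V.card - 4).choose 2 + 11 →
    H.card ≤ (V.card - 4).choose 2 + 11 ∧ (H.card = (V.card - 4).choose 2 + 11 → IsBOn V H) :=
    fun h => ⟨h.le, fun h' => absurd h' (by omega)⟩
  cases structural hH hfree (by omega) with
  | s0 x hx => exact absurd (sub_starplus_of_star hH (by omega) hx) hns
  | s1 h => exact strict (NT1 hV h)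
  | s2 D1 D2 h e =>
    apply strict
    have hc := h.card
    rw [← e, card_empty] at hc
    have h1 := (thmA h.t1.on_supp (h.free.mono (fun f hf => by simp [hf]))).1
    have h2 := (thmA h.t2.on_supp (h.free.mono (fun f hf => by simp [hf]))).1
    have hab := h.ab
    rcases le_total (supp D1).card (supp D2).card with hle | hle
    · have := NT2 hV h.a3 h.swap.a3 hab hle
      omega
    · have := NT2 hV h.swap.a3 h.a3 (by omega) hle
      omega
  | s3 D1 D2 R h e hR hc =>
    have hcd := h.card
    rw [← e] at hcd
    have h2 := thmA h.t2.on_supp (h.free.mono (fun f hf => by simp [hf]))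
    obtain ⟨p, hp⟩ := hc
    have h1 := card_star h.t1.on_supp (p := p) (fun d hd => com_sub hd hp)
    have := NT3 hV h.a3 h.swap.a3 h.ab
    refine ⟨by omega, fun heq => ?_⟩
    obtain ⟨a3, b3⟩ := this.2 (by omega)
    rw [e]
    have hch : ((supp D1).card - 1).choose 2 = 1 := by rw [a3]; rfl
    have := card_pos.2 h.ne1
    exact h.balloon (by omega) (by omega) (by omega) b3 (h2.2 (by omega) (by omega))
  | s4 D1 D2 R x h e hx hR hc =>
    have hcd := h.card
    rw [← e] at hcd
    obtain ⟨b4, hxs, h1 | ⟨a4, h1⟩ | ⟨c2, d2, a4, h1⟩ | ⟨a5, h1⟩⟩ := h.s4count hx hR hc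
    · obtain ⟨hxV, f, hfV, hf3, hxf, hs⟩ := h.s4star hx hR h1
      rw [← e] at hs
      exact absurd ⟨_, ⟨x, hxV, f, hfV, hf3, hxf, rfl⟩, hs⟩ hns
    · apply strict
      have := NT4 hV a4 b4 h.ab
      omega
    · exact absurd (e ▸ h.sub_cb hx hxs hR c2 d2) hncb
    · apply strict
      have := NT5 hV a5 b4 h.ab
      omega

/-- For `n ≥ 14`: every `𝒫₄`-free 3-graph `H` on `n` vertices that is a
sub-3-graph of neither the starplus `Sₙ⁺¹` nor the compact balloon `CBₙ`
satisfies `|H| ≤ C(n-4,2) + 11`, with equality iff `H` is isomorphic to the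
balloon `Bₙ`. -/
theorem third_order_turan_large (n : ℕ) (hn : 14 ≤ n)
    (V : Finset ℕ) (H : Finset (Finset ℕ)) (hV : V.card = n)
    (hH : ThreeGraphOn V H) (hfree : P4Free H)
    (hns : ¬SubStarPlus V H) (hncb : ¬SubCB V H) :
    H.card ≤ (n - 4).choose 2 + 11 ∧
      (H.card = (n - 4).choose 2 + 11 ↔ IsBOn V H) := by
  subst hV
  have h := main_bound hn hH hfree hns hncb
  exact ⟨h.1, h.2, fun hB => le_antisymm h.1 (balloon_card hB)⟩
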